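/- arXiv:1804.01782 — 5 statements merged into one kernel-verified Lean document; each statement's English description precedes it below -/
import Mathlib

section
/- Let N ≥ 2, α ∈ (0,1), λ > 0, and k ∈ ℕ^{N-1} with k ≠ 0. Define e_k(s) = ∏_{i=1}^{N-1} cos(k_i s_i) and |k| = (k₁² + ⋯ + k_{N-1}²)^{1/2}. Then for every s ∈ ℝ^{N-1}, 2λ^{1+α} · [ lim_{ε→0⁺} ∫_{{t : |t| ≥ ε}} (e_k(s) − e_k(s−t))/|t|^{N+α} dt − ∫_{ℝ^{N-1}} (e_k(s) + e_k(s−t)) (|t|² + 4λ²)^{−(N+α)/2} dt ] = ν(λ|k|) · e_k(s). -/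
open MeasureTheory Real Filter Topology

noncomputable section

abbrev ES (m : ℕ) : Type := EuclideanSpace ℝ (Fin (m + 1))

/-- `e_k(s) = ∏ᵢ cos(kᵢ sᵢ)`. -/
def ek {m : ℕ} (k : Fin (m + 1) → ℕ) (s : ES m) : ℝ :=
  ∏ i, Real.cos ((k i : ℝ) * s i)

/-- The eigenvalue function
`ν(R) = 2R^{1+α} (∫ (1-cos t₁)/|t|^{N+α} dt - ∫ (1+cos t₁)/(|t|²+4R²)^{(N+α)/2} dt)`,
with `N = m + 2`. -/
def nu (m : ℕ) (α : ℝ) (R : ℝ) : ℝ :=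
  2 * R ^ (1 + α) *
    ((∫ t : ES m, (1 - Real.cos (t 0)) / ‖t‖ ^ ((m : ℝ) + 2 + α)) -
      ∫ t : ES m, (1 + Real.cos (t 0)) / (‖t‖ ^ 2 + 4 * R ^ 2) ^ (((m : ℝ) + 2 + α) / 2))

lemma cos_prod_sum {n : ℕ} (x : Fin n → ℝ) :
    ∏ i, Real.cos (x i) = (1 / 2 ^ n) * ∑ T ∈ (Finset.univ : Finset (Fin n)).powerset,
      Real.cos (∑ i, (if i ∈ T then 1 else -1) * x i) := by
  have h : (∏ i, Complex.cos (x i : ℂ)) = (1 / 2 ^ n) *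
      ∑ T ∈ (Finset.univ : Finset (Fin n)).powerset,
      Complex.exp ((∑ i, (if i ∈ T then 1 else -1) * x i : ℝ) * Complex.I) := by
    simp only [Complex.cos]
    rw [Finset.prod_div_distrib, Finset.prod_add, div_eq_inv_mul]
    simp only [Finset.prod_const, Finset.card_univ, Fintype.card_fin, one_div]
    congr 1
    refine Finset.sum_congr rfl fun T _ => ?_
    rw [← Complex.exp_sum, ← Complex.exp_sum, ← Complex.exp_add]
    congr 1
    push_cast
    rw [Finset.sum_mul, ← Finset.sum_sdiff (Finset.subset_univ T), add_comm]
    congr 1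
    · refine Finset.sum_congr rfl fun i hi => ?_
      simp only [Finset.mem_sdiff, Finset.mem_univ, true_and] at hi
      simp [hi]
    · refine Finset.sum_congr rfl fun i hi => ?_
      simp [hi]
  have h2 := congrArg Complex.re h
  have e1 : (∏ i, Complex.cos (x i : ℂ)) = ((∏ i, Real.cos (x i) : ℝ) : ℂ) := by push_cast; rfl
  have e2 : (1 / 2 ^ n : ℂ) = ((1 / 2 ^ n : ℝ) : ℂ) := by push_cast; rfl
  rw [e1, e2, Complex.ofReal_re, Complex.re_ofReal_mul, Complex.re_sum] at h2
  rw [h2]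
  congr 1
  refine Finset.sum_congr rfl fun T _ => ?_
  rw [Complex.exp_ofReal_mul_I_re]

/-- signed frequency vector -/
def avec {m : ℕ} (k : Fin (m + 1) → ℕ) (T : Finset (Fin (m + 1))) : ES m :=
  WithLp.toLp 2 fun i => (if i ∈ T then 1 else -1) * (k i : ℝ)

lemma norm_avec {m : ℕ} (k : Fin (m + 1) → ℕ) (T : Finset (Fin (m + 1))) :
    ‖avec k T‖ = Real.sqrt (∑ i, (k i : ℝ) ^ 2) := by
  rw [EuclideanSpace.norm_eq]
  congr 1
  refine Finset.sum_congr rfl fun i _ => ?_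
  simp only [avec, Real.norm_eq_abs, sq_abs]
  split_ifs <;> ring

lemma ek_eq {m : ℕ} (k : Fin (m + 1) → ℕ) (s : ES m) :
    ek k s = (1 / 2 ^ (m + 1)) * ∑ T ∈ (Finset.univ : Finset (Fin (m + 1))).powerset,
      Real.cos (inner ℝ (avec k T) s) := by
  unfold ek
  rw [cos_prod_sum]
  congr 1
  refine Finset.sum_congr rfl fun T _ => ?_
  congr 1
  simp only [PiLp.inner_apply, avec, RCLike.inner_apply, conj_trivial]
  refine Finset.sum_congr rfl fun i _ => ?_
  ring

lemma rot {m : ℕ} (h : ℝ → ℝ) (a : ES m) :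
    ∫ t : ES m, h ‖t‖ * Real.cos (inner ℝ a t) = ∫ t : ES m, h ‖t‖ * Real.cos (‖a‖ * t 0) := by
  set w : ES m := ‖a‖ • EuclideanSpace.single 0 1 with hw
  have hn : ‖a‖ = ‖w‖ := by simp [hw, norm_smul]
  have hr := Submodule.reflection_sub hn
  set R : ES m ≃ₗᵢ[ℝ] ES m := Submodule.reflection (Submodule.span ℝ {a - w})ᗮ with hR
  have := (R.measurePreserving).integral_comp R.toHomeomorph.measurableEmbedding
    (fun t => h ‖t‖ * Real.cos (‖a‖ * t 0))
  rw [← this]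
  refine integral_congr_ae (ae_of_all _ fun t => ?_)
  have h1 : inner ℝ a t = inner ℝ w (R t) := by
    rw [← hr, R.inner_map_map]
  have h2 : inner ℝ w (R t) = ‖a‖ * (R t) 0 := by
    rw [hw, inner_smul_left, EuclideanSpace.inner_single_left]; simp
  simp only [LinearIsometryEquiv.norm_map]
  rw [h1, h2]

lemma odd_int {m : ℕ} (h : ℝ → ℝ) (a : ES m) :
    ∫ t : ES m, h ‖t‖ * Real.sin (inner ℝ a t) = 0 := by
  have := integral_neg_eq_self (fun t : ES m => h ‖t‖ * Real.sin (inner ℝ a t)) volume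
  simp only [norm_neg, inner_neg_right, Real.sin_neg, mul_neg, integral_neg] at this
  linarith

lemma main_int {m : ℕ} (h : ℝ → ℝ) (hi : Integrable (fun t : ES m => h ‖t‖))
    (k : Fin (m + 1) → ℕ) (s : ES m) :
    Integrable (fun t : ES m => h ‖t‖ * ek k (s - t)) ∧
    ∫ t : ES m, h ‖t‖ * ek k (s - t) =
      ek k s * ∫ t : ES m, h ‖t‖ * Real.cos (Real.sqrt (∑ i, (k i : ℝ) ^ 2) * t 0) := by
  have ic : ∀ a : ES m, Integrable (fun t : ES m => h ‖t‖ * Real.cos (inner ℝ a t)) := fun a =>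
    hi.mul_bdd (c := 1) (by fun_prop) (ae_of_all _ fun t => Real.abs_cos_le_one _)
  have is : ∀ a : ES m, Integrable (fun t : ES m => h ‖t‖ * Real.sin (inner ℝ a t)) := fun a =>
    hi.mul_bdd (c := 1) (by fun_prop) (ae_of_all _ fun t => Real.abs_sin_le_one _)
  have e : ∀ t : ES m, h ‖t‖ * ek k (s - t) = (1 / 2 ^ (m + 1)) *
      ∑ T ∈ (Finset.univ : Finset (Fin (m + 1))).powerset,
      (Real.cos (inner ℝ (avec k T) s) * (h ‖t‖ * Real.cos (inner ℝ (avec k T) t)) +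
       Real.sin (inner ℝ (avec k T) s) * (h ‖t‖ * Real.sin (inner ℝ (avec k T) t))) := by
    intro t
    rw [ek_eq, mul_left_comm, Finset.mul_sum]
    congr 1
    refine Finset.sum_congr rfl fun T _ => ?_
    rw [inner_sub_right, Real.cos_sub]
    ring
  have iT : ∀ T ∈ (Finset.univ : Finset (Fin (m + 1))).powerset, Integrable (fun t : ES m =>
      (Real.cos (inner ℝ (avec k T) s) * (h ‖t‖ * Real.cos (inner ℝ (avec k T) t)) +
       Real.sin (inner ℝ (avec k T) s) * (h ‖t‖ * Real.sin (inner ℝ (avec k T) t)))) :=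
    fun T _ => ((ic _).const_mul _).add ((is _).const_mul _)
  simp only [e]
  refine ⟨(integrable_finsetSum _ iT).const_mul _, ?_⟩
  rw [integral_const_mul, integral_finsetSum _ iT, ek_eq, mul_assoc, Finset.sum_mul]
  congr 1
  refine Finset.sum_congr rfl fun T _ => ?_
  rw [integral_add ((ic _).const_mul _) ((is _).const_mul _), integral_const_mul,
    integral_const_mul, odd_int, rot, norm_avec]
  ring

lemma rad_int {m : ℕ} (h : ℝ → ℝ) (hm : Measurable h) (a p C : ℝ) (ha : -((m : ℝ) + 1) < a)
    (hp : (m : ℝ) + 1 < p) (h0 : ∀ y, 0 < y → y ≤ 1 → |h y| ≤ C * y ^ a)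
    (h1 : ∀ y, 1 < y → |h y| ≤ C * y ^ (-p)) :
    Integrable (fun t : ES m => h ‖t‖) := by
  rw [integrable_fun_norm_addHaar (volume : Measure (ES m)) (f := h)]
  simp only [finrank_euclideanSpace, Fintype.card_fin, Nat.add_sub_cancel, smul_eq_mul]
  rw [← Set.Ioc_union_Ioi_eq_Ioi (zero_le_one' ℝ), integrableOn_union]
  constructor
  · have : IntegrableOn (fun y : ℝ => C * y ^ ((m : ℝ) + a)) (Set.Ioc 0 1) := by
      have := (intervalIntegral.intervalIntegrable_rpow' (a := 0) (b := 1)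
        (r := (m : ℝ) + a) (by linarith)).const_mul C
      rwa [intervalIntegrable_iff_integrableOn_Ioc_of_le zero_le_one] at this
    refine Integrable.mono' this (by fun_prop) ?_
    refine (ae_restrict_iff' measurableSet_Ioc).2 (ae_of_all _ fun y hy => ?_)
    rw [Real.norm_eq_abs, abs_mul, abs_of_nonneg (pow_nonneg hy.1.le _), Real.rpow_add hy.1,
      Real.rpow_natCast, mul_left_comm]
    exact mul_le_mul_of_nonneg_left (h0 y hy.1 hy.2) (pow_nonneg hy.1.le _)
  · have : IntegrableOn (fun y : ℝ => C * y ^ ((m : ℝ) + -p)) (Set.Ioi 1) :=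
      (integrableOn_Ioi_rpow_of_lt (by linarith) zero_lt_one).const_mul C
    refine Integrable.mono' this (by fun_prop) ?_
    refine (ae_restrict_iff' measurableSet_Ioi).2 (ae_of_all _ fun y hy => ?_)
    have hy0 : 0 < y := zero_lt_one.trans hy
    rw [Real.norm_eq_abs, abs_mul, abs_of_nonneg (pow_nonneg hy0.le _), Real.rpow_add hy0,
      Real.rpow_natCast, mul_left_comm]
    exact mul_le_mul_of_nonneg_left (h1 y hy) (pow_nonneg hy0.le _)

lemma trunc_int {m : ℕ} (p ε : ℝ) (hp : (m : ℝ) + 1 < p) (hε : 0 < ε) :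
    Integrable (fun t : ES m => (fun y : ℝ => if ε ≤ y then y ^ (-p) else 0) ‖t‖) := by
  have hp0 : 0 < p := by have := Nat.cast_nonneg (α := ℝ) m; linarith
  have hεp : 0 < ε ^ (-p) := Real.rpow_pos_of_pos hε _
  refine rad_int (fun y : ℝ => if ε ≤ y then y ^ (-p) else 0) ?_ 0 p (ε ^ (-p) + 1)
    (by have := Nat.cast_nonneg (α := ℝ) m; linarith) hp ?_ ?_
  · exact Measurable.ite measurableSet_Ici (by fun_prop) measurable_const
  · intro y hy _
    rw [Real.rpow_zero]
    split_ifs with hc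
    · rw [abs_of_nonneg (Real.rpow_nonneg hy.le _)]
      have := Real.rpow_le_rpow_of_nonpos hε hc (by linarith : -p ≤ 0)
      linarith
    · rw [abs_zero]; linarith
  · intro y hy
    have hy0 : 0 < y := zero_lt_one.trans hy
    have := Real.rpow_pos_of_pos hy0 (-p)
    split_ifs with hc
    · rw [abs_of_pos this]; nlinarith
    · rw [abs_zero]; positivity

lemma brk_int {m : ℕ} (p A : ℝ) (hp : (m : ℝ) + 1 < p) (hA : 0 < A) :
    Integrable (fun t : ES m => (fun y : ℝ => (y ^ 2 + A) ^ (-(p / 2))) ‖t‖) := by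
  have hp0 : 0 < p := by have := Nat.cast_nonneg (α := ℝ) m; linarith
  have hAp : 0 < A ^ (-(p / 2)) := Real.rpow_pos_of_pos hA _
  refine rad_int (fun y : ℝ => (y ^ 2 + A) ^ (-(p / 2))) (by fun_prop) 0 p (A ^ (-(p / 2)) + 1)
    (by have := Nat.cast_nonneg (α := ℝ) m; linarith) hp ?_ ?_
  · intro y hy _
    rw [Real.rpow_zero, abs_of_pos (by positivity)]
    have := Real.rpow_le_rpow_of_nonpos hA (by nlinarith : A ≤ y ^ 2 + A)
      (by linarith : -(p / 2) ≤ 0)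
    linarith
  · intro y hy
    have hy0 : 0 < y := zero_lt_one.trans hy
    have h1 := Real.rpow_pos_of_pos hy0 (-p)
    rw [abs_of_pos (by positivity)]
    have h2 := Real.rpow_le_rpow_of_nonpos (by positivity) (by linarith : y ^ 2 ≤ y ^ 2 + A)
      (by linarith : -(p / 2) ≤ 0)
    have h3 : (y ^ 2) ^ (-(p / 2)) = y ^ (-p) := by
      rw [← Real.rpow_natCast, ← Real.rpow_mul hy0.le]; congr 1; push_cast; ring
    rw [h3] at h2
    nlinarith

lemma sing_int {m : ℕ} (p K : ℝ) (hp : (m : ℝ) + 1 < p) (hp2 : p < (m : ℝ) + 3) :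
    Integrable (fun t : ES m => ‖t‖ ^ (-p) * (1 - Real.cos (K * t 0))) := by
  have hp0 : 0 < p := by have := Nat.cast_nonneg (α := ℝ) m; linarith
  have hb : Integrable (fun t : ES m => (fun y : ℝ => min 2 (K ^ 2 * y ^ 2) * y ^ (-p)) ‖t‖) := by
    refine rad_int (fun y : ℝ => min 2 (K ^ 2 * y ^ 2) * y ^ (-p)) ?_ (2 - p) p (K ^ 2 + 2)
      (by linarith) hp ?_ ?_
    · exact (measurable_const.min (by fun_prop)).mul (by fun_prop)
    · intro y hy _
      have h1 := Real.rpow_pos_of_pos hy (-p)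
      rw [abs_of_nonneg (by positivity), sub_eq_add_neg, Real.rpow_add hy, Real.rpow_two,
        ← mul_assoc]
      refine mul_le_mul_of_nonneg_right ((min_le_right _ _).trans ?_) h1.le
      nlinarith [sq_nonneg y]
    · intro y hy
      have hy0 : 0 < y := zero_lt_one.trans hy
      have h1 := Real.rpow_pos_of_pos hy0 (-p)
      rw [abs_of_nonneg (by positivity)]
      refine mul_le_mul_of_nonneg_right ((min_le_left _ _).trans ?_) h1.le
      nlinarith [sq_nonneg K]
  refine hb.mono' (Measurable.aestronglyMeasurable (by fun_prop)) (ae_of_all _ fun t => ?_)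
  have hc : 0 ≤ 1 - Real.cos (K * t 0) := by linarith [Real.cos_le_one (K * t 0)]
  have hn : (0 : ℝ) ≤ ‖t‖ ^ (-p) := Real.rpow_nonneg (norm_nonneg _) _
  rw [Real.norm_eq_abs, abs_of_nonneg (mul_nonneg hn hc), mul_comm]
  refine mul_le_mul_of_nonneg_right (le_min ?_ ?_) hn
  · linarith [Real.neg_one_le_cos (K * t 0)]
  · have h1 := Real.one_sub_sq_div_two_le_cos (x := K * t 0)
    have h2 : (t 0) ^ 2 ≤ ‖t‖ ^ 2 := by
      rw [← sq_abs (t 0), ← Real.norm_eq_abs]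
      exact pow_le_pow_left₀ (norm_nonneg _) (PiLp.norm_apply_le t 0) 2
    nlinarith [mul_le_mul_of_nonneg_left h2 (sq_nonneg K), sq_nonneg (K * t 0)]

lemma scale_int {m : ℕ} (f : ES m → ℝ) (K : ℝ) (hK : 0 < K) :
    ∫ t : ES m, f t = K ^ (m + 1) * ∫ t : ES m, f (K • t) := by
  rw [Measure.integral_comp_smul, finrank_euclideanSpace, Fintype.card_fin, smul_eq_mul,
    abs_of_pos (by positivity), ← mul_assoc, mul_inv_cancel₀ (by positivity), one_mul]

/-- for `k ≠ 0`, the principal value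
`lim_{ε→0⁺} ∫_{|t|≥ε} (e_k(s) - e_k(s-t))/|t|^{N+α} dt` exists, and
`2λ^{1+α} (PV - ∫ (e_k(s)+e_k(s-t))(|t|²+4λ²)^{-(N+α)/2} dt) = ν(λ|k|) e_k(s)`.
Here `N = m + 2 ≥ 2`. -/
theorem statement_5 (m : ℕ) (α lam : ℝ) (hα : α ∈ Set.Ioo (0 : ℝ) 1) (hlam : 0 < lam)
    (k : Fin (m + 1) → ℕ) (hk : k ≠ 0) (s : ES m) :
    ∃ L : ℝ,
      Tendsto
        (fun ε : ℝ => ∫ t in {t : ES m | ε ≤ ‖t‖},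
          (ek k s - ek k (s - t)) / ‖t‖ ^ ((m : ℝ) + 2 + α))
        (𝓝[>] (0 : ℝ)) (𝓝 L) ∧
      2 * lam ^ (1 + α) *
          (L - ∫ t : ES m,
            (ek k s + ek k (s - t)) * (‖t‖ ^ 2 + 4 * lam ^ 2) ^ (-(((m : ℝ) + 2 + α) / 2)))
        = nu m α (lam * Real.sqrt (∑ i, (k i : ℝ) ^ 2)) * ek k s := by
  obtain ⟨hα0, hα1⟩ := hα
  set p : ℝ := (m : ℝ) + 2 + α with hp
  have hp1 : (m : ℝ) + 1 < p := by linarith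
  have hp2 : p < (m : ℝ) + 3 := by linarith
  set K := Real.sqrt (∑ i, (k i : ℝ) ^ 2) with hKdef
  have hK : 0 < K := by
    apply Real.sqrt_pos.2
    obtain ⟨i, hi⟩ := Function.ne_iff.1 hk
    have hi' : (0 : ℝ) < (k i : ℝ) := by exact_mod_cast Nat.pos_of_ne_zero hi
    exact Finset.sum_pos' (fun _ _ => sq_nonneg _) ⟨i, Finset.mem_univ _, by positivity⟩
  have hcosb : ∀ h : ℝ → ℝ, Integrable (fun t : ES m => h ‖t‖) →
      Integrable (fun t : ES m => h ‖t‖ * Real.cos (K * t 0)) := fun h hi =>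
    hi.mul_bdd (c := 1) (by fun_prop) (ae_of_all _ fun t => Real.abs_cos_le_one _)
  have hS := sing_int p K hp1 hp2
  set I1 : ℝ := ∫ t : ES m, ‖t‖ ^ (-p) * (1 - Real.cos (K * t 0)) with hI1
  refine ⟨ek k s * I1, ?_, ?_⟩
  · have hT : Tendsto (fun ε : ℝ => ek k s * ∫ t : ES m, {t : ES m | ε ≤ ‖t‖}.indicator
        (fun t => ‖t‖ ^ (-p) * (1 - Real.cos (K * t 0))) t) (𝓝[>] (0 : ℝ)) (𝓝 (ek k s * I1)) := by
      refine Tendsto.const_mul _ ?_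
      refine tendsto_integral_filter_of_dominated_convergence
        (fun t => ‖‖t‖ ^ (-p) * (1 - Real.cos (K * t 0))‖) ?_ ?_ hS.norm ?_
      · refine Eventually.of_forall fun ε => hS.1.indicator ?_
        exact measurableSet_le measurable_const measurable_norm
      · exact Eventually.of_forall fun ε => ae_of_all _ fun t => norm_indicator_le_norm_self _ _
      · refine ae_of_all _ fun t => ?_
        by_cases ht : t = 0
        · subst ht
          have : ∀ ε : ℝ, {t : ES m | ε ≤ ‖t‖}.indicator
              (fun t : ES m => ‖t‖ ^ (-p) * (1 - Real.cos (K * t 0))) 0 = 0 := by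
            intro ε
            simp [Set.indicator]
          simp only [this]
          simp
        · refine tendsto_const_nhds.congr' ?_
          have : Set.Ioo 0 ‖t‖ ∈ 𝓝[>] (0 : ℝ) := Ioo_mem_nhdsGT (norm_pos_iff.2 ht)
          filter_upwards [this] with ε hε
          rw [Set.indicator_of_mem]
          exact hε.2.le
    refine hT.congr' ?_
    filter_upwards [self_mem_nhdsWithin] with ε hε
    have hε0 : (0 : ℝ) < ε := hε
    have hms : MeasurableSet {t : ES m | ε ≤ ‖t‖} :=
      measurableSet_le measurable_const measurable_norm
    set h : ℝ → ℝ := fun y => if ε ≤ y then y ^ (-p) else 0 with hh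
    have hi : Integrable (fun t : ES m => h ‖t‖) := trunc_int p ε hp1 hε0
    obtain ⟨m1, m2⟩ := main_int h hi k s
    rw [← integral_indicator hms]
    have e1 : ∀ t : ES m, {t : ES m | ε ≤ ‖t‖}.indicator
        (fun t => (ek k s - ek k (s - t)) / ‖t‖ ^ p) t
        = ek k s * h ‖t‖ - h ‖t‖ * ek k (s - t) := by
      intro t
      by_cases ht : ε ≤ ‖t‖
      · rw [Set.indicator_of_mem (show t ∈ {t : ES m | ε ≤ ‖t‖} from ht)]
        simp only [hh, if_pos ht, Real.rpow_neg (norm_nonneg t), div_eq_mul_inv]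
        ring
      · rw [Set.indicator_of_notMem (show t ∉ {t : ES m | ε ≤ ‖t‖} from ht)]
        simp [hh, if_neg ht]
    have e2 : ∀ t : ES m, {t : ES m | ε ≤ ‖t‖}.indicator
        (fun t => ‖t‖ ^ (-p) * (1 - Real.cos (K * t 0))) t
        = h ‖t‖ - h ‖t‖ * Real.cos (K * t 0) := by
      intro t
      by_cases ht : ε ≤ ‖t‖
      · rw [Set.indicator_of_mem (show t ∈ {t : ES m | ε ≤ ‖t‖} from ht)]
        simp only [hh, if_pos ht]
        ring
      · rw [Set.indicator_of_notMem (show t ∉ {t : ES m | ε ≤ ‖t‖} from ht)]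
        simp [hh, if_neg ht]
    simp only [e1, e2]
    rw [integral_sub hi (hcosb h hi), integral_sub (hi.const_mul _) m1, m2, integral_const_mul]
    ring
  · set A : ℝ := 4 * lam ^ 2 with hA
    have hA0 : 0 < A := by positivity
    set g : ℝ → ℝ := fun y => (y ^ 2 + A) ^ (-(p / 2)) with hg
    have hi : Integrable (fun t : ES m => g ‖t‖) := brk_int p A hp1 hA0
    obtain ⟨m1, m2⟩ := main_int g hi k s
    have e1 : ∫ t : ES m, (ek k s + ek k (s - t)) * (‖t‖ ^ 2 + A) ^ (-(p / 2)) =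
        ek k s * ∫ t : ES m, g ‖t‖ * (1 + Real.cos (K * t 0)) := by
      have a1 : ∀ t : ES m, (ek k s + ek k (s - t)) * (‖t‖ ^ 2 + A) ^ (-(p / 2)) =
          ek k s * g ‖t‖ + g ‖t‖ * ek k (s - t) := fun t => by simp only [hg]; ring
      have a2 : ∀ t : ES m, g ‖t‖ * (1 + Real.cos (K * t 0)) =
          g ‖t‖ + g ‖t‖ * Real.cos (K * t 0) := fun t => by ring
      simp only [a1, a2]
      rw [integral_add hi (hcosb g hi), integral_add (hi.const_mul _) m1, m2, integral_const_mul]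
      ring
    have hKp : K ^ (m + 1) * K ^ (-p) = (K ^ (1 + α))⁻¹ := by
      rw [← Real.rpow_natCast, ← Real.rpow_add hK, ← Real.rpow_neg hK.le]
      congr 1
      push_cast
      rw [hp]; ring
    have e2 : ∫ t : ES m, (1 - Real.cos (t 0)) / ‖t‖ ^ p = (K ^ (1 + α))⁻¹ * I1 := by
      rw [scale_int _ K hK, ← hKp, mul_assoc, hI1, ← integral_const_mul (K ^ (-p))]
      congr 1
      refine integral_congr_ae (ae_of_all _ fun t => ?_)
      simp only [norm_smul, Real.norm_eq_abs, abs_of_pos hK, PiLp.smul_apply, smul_eq_mul]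
      rw [div_eq_mul_inv, ← Real.rpow_neg (by positivity), Real.mul_rpow hK.le (norm_nonneg _)]
      ring
    have e3 : ∫ t : ES m, (1 + Real.cos (t 0)) / (‖t‖ ^ 2 + 4 * (lam * K) ^ 2) ^ (p / 2) =
        (K ^ (1 + α))⁻¹ * ∫ t : ES m, g ‖t‖ * (1 + Real.cos (K * t 0)) := by
      rw [scale_int _ K hK, ← hKp, mul_assoc, ← integral_const_mul (K ^ (-p))]
      congr 1
      refine integral_congr_ae (ae_of_all _ fun t => ?_)
      simp only [norm_smul, Real.norm_eq_abs, abs_of_pos hK, PiLp.smul_apply, smul_eq_mul]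
      have b1 : (K * ‖t‖) ^ 2 + 4 * (lam * K) ^ 2 = K ^ 2 * (‖t‖ ^ 2 + A) := by rw [hA]; ring
      have b2 : (K ^ 2) ^ (-(p / 2)) = K ^ (-p) := by
        rw [← Real.rpow_natCast, ← Real.rpow_mul hK.le]; congr 1; push_cast; ring
      rw [b1, div_eq_mul_inv, ← Real.rpow_neg (by positivity),
        Real.mul_rpow (by positivity) (by positivity), b2]
      ring
    rw [e1]
    unfold nu
    rw [← hp, e2, e3, Real.mul_rpow hlam.le hK.le]
    have : K ^ (1 + α) ≠ 0 := (Real.rpow_pos_of_pos hK _).ne'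
    field_simp
end
end

section
/- Let N ≥ 2, α ∈ (0,1), and let θ ∈ ℝ^{N-1} with |θ| = 1. Then ∫_{ℝ^{N-1}} (1 − ∏_{i=1}^{N-1} cos(t_i θ_i))/|t|^{N+α} dt = ∫_{ℝ^{N-1}} (1 − cos t₁)/|t|^{N+α} dt, both integrals being absolutely convergent; in particular the left-hand side does not depend on the unit vector θ. -/
open MeasureTheory Real Filter Topology

noncomputable section

theorem radial_bound (m : ℕ) (α : ℝ) (hα : α ∈ Set.Ioo (0 : ℝ) 1) :
    Integrable (fun t : ES m => min (‖t‖ ^ 2) 2 / ‖t‖ ^ ((m : ℝ) + 2 + α)) := by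
  obtain ⟨h0, h1⟩ := hα
  have key := (integrable_fun_norm_addHaar (volume : Measure (ES m))
    (f := fun r : ℝ => min (r ^ 2) 2 / r ^ ((m : ℝ) + 2 + α)))
  refine key.2 ?_
  have hd : Module.finrank ℝ (ES m) - 1 = m := by simp
  rw [hd]
  have hmeas : Measurable
      (fun y : ℝ => y ^ m • (min (y ^ 2) 2 / y ^ ((m : ℝ) + 2 + α))) := by fun_prop
  have e : ∀ y : ℝ, 0 < y → y ^ m • (min (y ^ 2) 2 / y ^ ((m : ℝ) + 2 + α))
      = min (y ^ 2) 2 * y ^ (-2 - α) := by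
    intro y hy
    have : y ^ (-2 - α) = y ^ (m : ℝ) / y ^ ((m : ℝ) + 2 + α) := by
      rw [← Real.rpow_sub hy]; congr 1; ring
    rw [this, Real.rpow_natCast, smul_eq_mul]; ring
  have hu : Set.Ioi (0 : ℝ) = Set.Ioo 0 2 ∪ Set.Ioi 1 := by
    ext y
    simp only [Set.mem_Ioi, Set.mem_union, Set.mem_Ioo]
    constructor
    · intro hy
      rcases lt_or_ge y 2 with h | h
      · exact Or.inl ⟨hy, h⟩
      · right; linarith
    · rintro (h | h)
      · exact h.1
      · linarith
  rw [hu]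
  refine IntegrableOn.union ?_ ?_
  · have hi : IntegrableOn (fun x : ℝ => x ^ (-α)) (Set.Ioo (0 : ℝ) 2) :=
      (intervalIntegral.integrableOn_Ioo_rpow_iff (by norm_num)).2 (by linarith)
    refine Integrable.mono' hi hmeas.aestronglyMeasurable ?_
    refine (ae_restrict_iff' measurableSet_Ioo).2 (Eventually.of_forall ?_)
    intro y hy
    have hy0 := hy.1
    rw [e y hy0, Real.norm_of_nonneg (by positivity)]
    have : y ^ (-α) = y ^ 2 * y ^ (-2 - α) := by
      rw [← Real.rpow_natCast y 2, ← Real.rpow_add hy0]; congr 1; push_cast; ring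
    rw [this]
    gcongr
    exact min_le_left _ _
  · have hi : IntegrableOn (fun x : ℝ => 2 * x ^ (-2 - α)) (Set.Ioi (1 : ℝ)) :=
      (integrableOn_Ioi_rpow_of_lt (by linarith) one_pos).const_mul 2
    refine Integrable.mono' hi hmeas.aestronglyMeasurable ?_
    refine (ae_restrict_iff' measurableSet_Ioi).2 (Eventually.of_forall ?_)
    intro y hy
    have hy0 : 0 < y := lt_trans one_pos hy
    rw [e y hy0, Real.norm_of_nonneg (by positivity)]
    gcongr
    exact min_le_right _ _

theorem integrable_unit (m : ℕ) (α : ℝ) (hα : α ∈ Set.Ioo (0 : ℝ) 1) (u : ES m)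
    (hu : ‖u‖ = 1) :
    Integrable (fun t : ES m => (1 - Real.cos (inner ℝ u t)) / ‖t‖ ^ ((m : ℝ) + 2 + α)) := by
  refine Integrable.mono' (radial_bound m α hα) ?_ (Eventually.of_forall ?_)
  · apply Measurable.aestronglyMeasurable
    fun_prop
  · intro t
    have h1 : 0 ≤ 1 - Real.cos (inner ℝ u t) := by linarith [Real.cos_le_one (inner ℝ u t)]
    rw [Real.norm_of_nonneg (by positivity)]
    gcongr
    refine le_min ?_ (by linarith [Real.neg_one_le_cos (inner ℝ u t)])
    have h2 := Real.one_sub_sq_div_two_le_cos (x := inner ℝ u t)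
    have h3 : |inner ℝ u t| ≤ ‖t‖ := by
      have := abs_real_inner_le_norm u t
      rwa [hu, one_mul] at this
    have h4 : (inner ℝ u t) ^ 2 ≤ ‖t‖ ^ 2 := by
      rw [← sq_abs]; gcongr
    nlinarith [sq_nonneg (inner ℝ u t)]

theorem integral_unit (m : ℕ) (s : ℝ) (u v : ES m) (huv : ‖u‖ = ‖v‖) :
    ∫ t : ES m, (1 - Real.cos (inner ℝ u t)) / ‖t‖ ^ s
      = ∫ t : ES m, (1 - Real.cos (inner ℝ v t)) / ‖t‖ ^ s := by
  set R := Submodule.reflection (Submodule.span ℝ {u - v})ᗮ with hR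
  have hRu : R u = v := Submodule.reflection_sub huv
  rw [← R.measurePreserving.integral_comp R.toHomeomorph.measurableEmbedding
    (fun t : ES m => (1 - Real.cos (inner ℝ v t)) / ‖t‖ ^ s)]
  congr 1
  ext t
  rw [← hRu, R.inner_map_map, R.norm_map]

theorem prod_cos_eq (n : ℕ) (x : Fin n → ℝ) :
    ∏ i, Real.cos (x i)
      = (2 ^ n : ℝ)⁻¹ * ∑ ε : Fin n → ℤˣ, Real.cos (∑ i, ((ε i : ℤ) : ℝ) * x i) := by
  have h : ∀ i, (Real.cos (x i) : ℂ)
      = 2⁻¹ * ∑ e : ℤˣ, Complex.exp (((((e : ℤ) : ℝ) * x i : ℝ) : ℂ) * Complex.I) := by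
    intro i
    rw [Complex.ofReal_cos, Complex.cos, UnitsInt.univ]
    rw [Finset.sum_insert (by decide), Finset.sum_singleton]
    simp
    ring
  have hc : ((∏ i, Real.cos (x i) : ℝ) : ℂ) = (((2 ^ n : ℝ)⁻¹ : ℝ) : ℂ) *
      ∑ ε : Fin n → ℤˣ, Complex.exp (((∑ i, ((ε i : ℤ) : ℝ) * x i : ℝ) : ℂ) * Complex.I) := by
    rw [Complex.ofReal_prod, Finset.prod_congr rfl (fun i _ => h i), Finset.prod_mul_distrib,
      Finset.prod_univ_sum]
    congr 1
    · simp
    · rw [Fintype.piFinset_univ]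
      refine Finset.sum_congr rfl fun ε _ => ?_
      rw [← Complex.exp_sum, Complex.ofReal_sum, Finset.sum_mul]
  have := congrArg Complex.re hc
  rw [Complex.ofReal_re, Complex.re_ofReal_mul, Complex.re_sum] at this
  rw [this]
  simp only [Complex.exp_ofReal_mul_I_re]

/-- `θ` with signs changed by `ε`. -/
def signFlip (m : ℕ) (ε : Fin (m + 1) → ℤˣ) (θ : ES m) : ES m :=
  WithLp.toLp 2 (fun i => ((ε i : ℤ) : ℝ) * θ i)

theorem norm_flip (m : ℕ) (ε : Fin (m + 1) → ℤˣ) (θ : ES m) : ‖signFlip m ε θ‖ = ‖θ‖ := by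
  rw [EuclideanSpace.norm_eq, EuclideanSpace.norm_eq]
  congr 1
  refine Finset.sum_congr rfl fun i _ => ?_
  rcases Int.units_eq_one_or (ε i) with h | h <;> simp [signFlip, h]

theorem integrand_eq (m : ℕ) (s : ℝ) (θ t : ES m) :
    (1 - ∏ i, Real.cos (t i * θ i)) / ‖t‖ ^ s
      = (2 ^ (m + 1) : ℝ)⁻¹ * ∑ ε : Fin (m + 1) → ℤˣ,
        (1 - Real.cos (inner ℝ (signFlip m ε θ) t)) / ‖t‖ ^ s := by
  have hi : ∀ ε : Fin (m + 1) → ℤˣ,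
      inner ℝ (signFlip m ε θ) t = ∑ i, ((ε i : ℤ) : ℝ) * (t i * θ i) := by
    intro ε
    simp only [PiLp.inner_apply, signFlip]
    refine Finset.sum_congr rfl fun i _ => ?_
    simp
    ring
  rw [prod_cos_eq, ← Finset.sum_div, Finset.sum_sub_distrib]
  simp only [hi]
  have hcard : ∑ _ε : Fin (m + 1) → ℤˣ, (1 : ℝ) = 2 ^ (m + 1) := by simp
  rw [hcard, ← mul_div_assoc, mul_sub, inv_mul_cancel₀ (by positivity)]

/-- for a unit vector `θ ∈ ℝ^{N-1}`,
`∫ (1 - ∏ᵢ cos(tᵢθᵢ))/|t|^{N+α} dt = ∫ (1 - cos t₁)/|t|^{N+α} dt`, both integrals being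
absolutely convergent; in particular the left-hand side is independent of `θ`.
Here `N = m + 2 ≥ 2`. -/
theorem statement_6 (m : ℕ) (α : ℝ) (hα : α ∈ Set.Ioo (0 : ℝ) 1)
    (θ : ES m) (hθ : ‖θ‖ = 1) :
    Integrable (fun t : ES m => (1 - ∏ i, Real.cos (t i * θ i)) / ‖t‖ ^ ((m : ℝ) + 2 + α)) ∧
      Integrable (fun t : ES m => (1 - Real.cos (t 0)) / ‖t‖ ^ ((m : ℝ) + 2 + α)) ∧
      ∫ t : ES m, (1 - ∏ i, Real.cos (t i * θ i)) / ‖t‖ ^ ((m : ℝ) + 2 + α)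
        = ∫ t : ES m, (1 - Real.cos (t 0)) / ‖t‖ ^ ((m : ℝ) + 2 + α) := by
  have he : ∀ t : ES m, t 0 = inner ℝ (EuclideanSpace.single (0 : Fin (m + 1)) (1 : ℝ) : ES m) t := by
    intro t
    simp [EuclideanSpace.inner_single_left]
  have hn : ‖(EuclideanSpace.single (0 : Fin (m + 1)) (1 : ℝ) : ES m)‖ = 1 := by simp
  have hf : ∀ ε, ‖signFlip m ε θ‖ = 1 := fun ε => (norm_flip m ε θ).trans hθ
  have hI := fun ε => integrable_unit m α hα (signFlip m ε θ) (hf ε)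
  simp only [integrand_eq, he]
  refine ⟨(integrable_finsetSum _ fun ε _ => hI ε).const_mul _,
    integrable_unit m α hα _ hn, ?_⟩
  rw [integral_const_mul, integral_finsetSum _ fun ε _ => hI ε,
    Finset.sum_congr rfl fun ε _ => integral_unit m _ (signFlip m ε θ) _ ((hf ε).trans hn.symm)]
  rw [Finset.sum_const, nsmul_eq_mul]
  have hcard : ((Finset.univ : Finset (Fin (m + 1) → ℤˣ)).card : ℝ) = 2 ^ (m + 1) := by simp
  rw [hcard, inv_mul_cancel_left₀ (by positivity)]
end
end

section
/- Let N ≥ 2 and α ∈ (0,1). Then there exists a unique λ* > 0 such that ν(λ*) = 0; moreover ν(R) < 0 for 0 < R < λ* and ν(R) > 0 for R > λ*. -/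
open MeasureTheory Real Filter Topology

noncomputable section

def Bk (m : ℕ) (α R : ℝ) (t : ES m) : ℝ :=
  (1 + Real.cos (t 0)) / (‖t‖ ^ 2 + 4 * R ^ 2) ^ (((m : ℝ) + 2 + α) / 2)

def Ak (m : ℕ) (α : ℝ) (t : ES m) : ℝ :=
  (1 - Real.cos (t 0)) / ‖t‖ ^ ((m : ℝ) + 2 + α)

lemma coord_cont (m : ℕ) : Continuous (fun t : ES m => t 0) := by fun_prop

lemma Bk_nonneg (m : ℕ) (α R : ℝ) (t : ES m) : 0 ≤ Bk m α R t := by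
  unfold Bk
  have := Real.neg_one_le_cos (t 0)
  apply div_nonneg (by linarith) (by positivity)

lemma Bk_anti (m : ℕ) {α R S : ℝ} (hα : 0 < α) (hR : 0 < R) (h : R ≤ S) (t : ES m) :
    Bk m α S t ≤ Bk m α R t := by
  unfold Bk
  have := Real.neg_one_le_cos (t 0)
  have : 0 ≤ 1 + Real.cos (t 0) := by linarith
  gcongr

lemma Bk_cont (m : ℕ) {α R : ℝ} (hR : 0 < R) : Continuous (Bk m α R) := by
  unfold Bk
  have := coord_cont m
  refine Continuous.div (by fun_prop) ?_ ?_
  · refine Continuous.rpow_const (by fun_prop) ?_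
    intro t; left; positivity
  · intro t; positivity

lemma Bk_integrable (m : ℕ) {α R : ℝ} (hα : 0 < α) (hR : 0 < R) :
    Integrable (Bk m α R) := by
  have h1 : Integrable (fun x : ES m => ((1 : ℝ) + ‖x‖ ^ 2) ^ (-((m : ℝ) + 2 + α) / 2)) :=
    integrable_rpow_neg_one_add_norm_sq (by simp; linarith)
  set c : ℝ := min 1 (4 * R ^ 2) with hc
  have hc0 : 0 < c := by rw [hc]; positivity
  refine (h1.const_mul (2 * c ^ (-((m : ℝ) + 2 + α) / 2))).mono'
    (Bk_cont m hR).aestronglyMeasurable (Eventually.of_forall fun t => ?_)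
  rw [Real.norm_of_nonneg (Bk_nonneg m α R t), mul_assoc,
    ← Real.mul_rpow hc0.le (by positivity)]
  unfold Bk
  rw [div_eq_mul_inv, ← Real.rpow_neg (by positivity), ← neg_div]
  have hle : c * (1 + ‖t‖ ^ 2) ≤ ‖t‖ ^ 2 + 4 * R ^ 2 := by
    have a1 : c ≤ 1 := min_le_left _ _
    have a2 : c ≤ 4 * R ^ 2 := min_le_right _ _
    nlinarith [sq_nonneg ‖t‖]
  have hp : ((‖t‖ ^ 2 + 4 * R ^ 2) ^ (-((m : ℝ) + 2 + α) / 2)) ≤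
      (c * (1 + ‖t‖ ^ 2)) ^ (-((m : ℝ) + 2 + α) / 2) := by
    apply Real.rpow_le_rpow_of_nonpos (by positivity) hle
    have : (0 : ℝ) ≤ m := by positivity
    linarith
  have := Real.cos_le_one (t 0)
  apply mul_le_mul (by linarith) hp (by positivity) (by norm_num)

lemma B_strict (m : ℕ) {α R S : ℝ} (hα : 0 < α) (hR : 0 < R) (h : R < S) :
    ∫ t, Bk m α S t < ∫ t, Bk m α R t := by
  have hS := hR.trans h
  rw [← sub_pos, ← integral_sub (Bk_integrable m hα hR) (Bk_integrable m hα hS)]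
  refine integral_pos_of_integrable_nonneg_nonzero (x := (0 : ES m))
    ((Bk_cont m hR).sub (Bk_cont m hS))
    ((Bk_integrable m hα hR).sub (Bk_integrable m hα hS)) ?_ ?_
  · intro t
    simpa using Bk_anti m hα hR h.le t
  · apply ne_of_gt
    rw [sub_pos]
    unfold Bk
    simp only [PiLp.zero_apply, Real.cos_zero, norm_zero]
    have : (0 ^ 2 + 4 * R ^ 2) ^ (((m : ℝ) + 2 + α) / 2) <
        (0 ^ 2 + 4 * S ^ 2) ^ (((m : ℝ) + 2 + α) / 2) := by
      apply Real.rpow_lt_rpow (by positivity) _ (by positivity)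
      nlinarith
    gcongr

lemma B_cont (m : ℕ) {α R : ℝ} (hα : 0 < α) (hR : 0 < R) :
    ContinuousAt (fun R => ∫ t, Bk m α R t) R := by
  refine continuousAt_of_dominated (bound := Bk m α (R / 2)) ?_ ?_
    (Bk_integrable m hα (by positivity)) ?_
  · filter_upwards [lt_mem_nhds hR] with S hS
    exact (Bk_cont m hS).aestronglyMeasurable
  · filter_upwards [lt_mem_nhds (show R / 2 < R by linarith)] with S hS
    refine Eventually.of_forall fun t => ?_
    rw [Real.norm_of_nonneg (Bk_nonneg m α S t)]
    exact Bk_anti m hα (by positivity) hS.le t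
  · refine Eventually.of_forall fun t => ?_
    unfold Bk
    refine ContinuousAt.div (by fun_prop) ?_ (by positivity)
    refine ContinuousAt.rpow_const (by fun_prop) ?_
    left; positivity

lemma B_tendsto (m : ℕ) {α : ℝ} (hα : 0 < α) :
    Tendsto (fun R => ∫ t, Bk m α R t) atTop (𝓝 0) := by
  rw [show (0 : ℝ) = ∫ t : ES m, (0 : ℝ) by simp]
  refine tendsto_integral_filter_of_dominated_convergence (Bk m α 1) ?_ ?_
    (Bk_integrable m hα one_pos) ?_
  · filter_upwards [eventually_gt_atTop 0] with S hS
    exact (Bk_cont m hS).aestronglyMeasurable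
  · filter_upwards [eventually_ge_atTop 1] with S hS
    refine Eventually.of_forall fun t => ?_
    rw [Real.norm_of_nonneg (Bk_nonneg m α S t)]
    exact Bk_anti m hα one_pos hS t
  · refine Eventually.of_forall fun t => ?_
    unfold Bk
    refine Tendsto.const_div_atTop ?_ _
    refine (tendsto_rpow_atTop (by positivity)).comp ?_
    refine tendsto_atTop_add_const_left _ _ ?_
    exact (tendsto_pow_atTop (by norm_num)).const_mul_atTop (by norm_num)

lemma B_large (m : ℕ) {α : ℝ} (hα : 0 < α) (A : ℝ) :
    ∃ R : ℝ, 0 < R ∧ A < ∫ t, Bk m α R t := by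
  set v : ℝ := volume.real (Metric.ball (0 : ES m) 1) with hv
  have hv0 : 0 < v := by
    rw [hv]
    exact ENNReal.toReal_pos (Metric.measure_ball_pos _ _ one_pos).ne' measure_ball_lt_top.ne
  set c : ℝ := v / 5 ^ (((m : ℝ) + 2 + α) / 2) with hc
  have hc0 : 0 < c := by positivity
  have key : ∀ R : ℝ, 0 < R → R ≤ 1 → c * R⁻¹ ^ (1 + α) ≤ ∫ t, Bk m α R t := by
    intro R hR hR1
    have h1 : ∫ t in Metric.ball (0 : ES m) R, Bk m α R t ≤ ∫ t, Bk m α R t :=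
      setIntegral_le_integral (Bk_integrable m hα hR) (Eventually.of_forall (Bk_nonneg m α R))
    refine le_trans ?_ h1
    have h2 : ∫ t in Metric.ball (0 : ES m) R, (1 / (5 * R ^ 2) ^ (((m : ℝ) + 2 + α) / 2)) ≤
        ∫ t in Metric.ball (0 : ES m) R, Bk m α R t := by
      refine setIntegral_mono_on ?_ (Bk_integrable m hα hR).integrableOn measurableSet_ball ?_
      · exact integrableOn_const measure_ball_lt_top.ne
      · intro t ht
        rw [mem_ball_zero_iff] at ht
        have hn := norm_nonneg t
        have hcos : 0 ≤ Real.cos (t 0) := by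
          apply (Real.cos_pos_of_le_one _).le
          have := PiLp.norm_apply_le t 0
          rw [Real.norm_eq_abs] at this
          linarith
        unfold Bk
        gcongr
        · linarith
        · nlinarith
    refine le_trans (le_of_eq ?_) h2
    rw [setIntegral_const, smul_eq_mul, Measure.real, Measure.addHaar_ball_of_pos _ _ hR,
      ENNReal.toReal_mul, ENNReal.toReal_ofReal (by positivity)]
    change _ = _ * v * _
    rw [Real.mul_rpow (by norm_num) (by positivity), ← Real.rpow_natCast R 2,
      ← Real.rpow_mul hR.le, Real.inv_rpow hR.le, hc]
    simp only [finrank_euclideanSpace, Fintype.card_fin]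
    rw [← Real.rpow_natCast R (m + 1)]
    rw [show ((2 : ℕ) : ℝ) * (((m : ℝ) + 2 + α) / 2) = ((m + 1 : ℕ) : ℝ) + (1 + α) by
      push_cast; ring, Real.rpow_add hR ((m + 1 : ℕ) : ℝ) (1 + α)]
    have := Real.rpow_pos_of_pos hR ((m + 1 : ℕ) : ℝ)
    have := Real.rpow_pos_of_pos hR (1 + α)
    have : (0 : ℝ) < 5 ^ (((m : ℝ) + 2 + α) / 2) := by positivity
    generalize R ^ ((m + 1 : ℕ) : ℝ) = x at *
    generalize R ^ (1 + α) = y at *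
    field_simp
  have ht : Tendsto (fun x : ℝ => c * x ^ (1 + α)) atTop atTop :=
    (tendsto_rpow_atTop (by positivity)).const_mul_atTop hc0
  obtain ⟨x, hx, hx1⟩ := ((ht.eventually_gt_atTop A).and (eventually_ge_atTop 1)).exists
  refine ⟨x⁻¹, by positivity, lt_of_lt_of_le ?_ (key x⁻¹ (by positivity) (inv_le_one_of_one_le₀ hx1))⟩
  simpa using hx

lemma Ak_nonneg (m : ℕ) (α : ℝ) (t : ES m) : 0 ≤ Ak m α t := by
  unfold Ak
  have := Real.cos_le_one (t 0)
  apply div_nonneg (by linarith) (by positivity)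

lemma Ak_integrable (m : ℕ) {α : ℝ} (hα : α ∈ Set.Ioo (0 : ℝ) 1) : Integrable (Ak m α) := by
  obtain ⟨h0, h1⟩ := hα
  have hrad : Integrable (fun t : ES m =>
      (fun y : ℝ => min (y ^ 2) 2 / y ^ ((m : ℝ) + 2 + α)) ‖t‖) := by
    rw [integrable_fun_norm_addHaar volume
      (f := fun y : ℝ => min (y ^ 2) 2 / y ^ ((m : ℝ) + 2 + α))]
    rw [← Set.Ioo_union_Ici_eq_Ioi (zero_lt_one' ℝ), integrableOn_union]
    have hm : Measurable (fun y : ℝ => y ^ (Module.finrank ℝ (ES m) - 1) •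
        (min (y ^ 2) 2 / y ^ ((m : ℝ) + 2 + α))) := by fun_prop
    have hid : ∀ y : ℝ, 0 < y → ‖y ^ (Module.finrank ℝ (ES m) - 1) •
        (min (y ^ 2) 2 / y ^ ((m : ℝ) + 2 + α))‖ = min (y ^ 2) 2 * y ^ (-(2 + α)) := by
      intro y hy
      rw [Real.norm_of_nonneg (by positivity)]
      simp only [finrank_euclideanSpace, Fintype.card_fin, smul_eq_mul, add_tsub_cancel_right]
      rw [Real.rpow_neg hy.le, show (m : ℝ) + 2 + α = m + (2 + α) by ring, Real.rpow_add hy,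
        Real.rpow_natCast]
      have := Real.rpow_pos_of_pos hy (2 + α)
      field_simp
    constructor
    · have := (intervalIntegral.integrableOn_Ioo_rpow_iff (s := -α) one_pos).2 (by linarith)
      refine Integrable.mono' this hm.aestronglyMeasurable ?_
      refine ae_restrict_of_forall_mem measurableSet_Ioo fun y hy => ?_
      rw [hid y hy.1]
      calc min (y ^ 2) 2 * y ^ (-(2 + α)) ≤ y ^ 2 * y ^ (-(2 + α)) := by
            have := hy.1
            gcongr; exact min_le_left _ _
        _ = y ^ (-α) := by
            rw [← Real.rpow_natCast, ← Real.rpow_add hy.1]; congr 1; push_cast; ring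
    · rw [integrableOn_Ici_iff_integrableOn_Ioi]
      have := (integrableOn_Ioi_rpow_of_lt (a := -(2 + α)) (by linarith) one_pos).const_mul 2
      refine Integrable.mono' this hm.aestronglyMeasurable ?_
      refine ae_restrict_of_forall_mem measurableSet_Ioi fun y hy => ?_
      have hy0 : 0 < y := one_pos.trans hy
      rw [hid y hy0]
      gcongr; exact min_le_right _ _
  refine hrad.mono' ?_ (Eventually.of_forall fun t => ?_)
  · have := coord_cont m
    apply Measurable.aestronglyMeasurable
    unfold Ak
    fun_prop
  · rw [Real.norm_of_nonneg (Ak_nonneg m α t)]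
    unfold Ak
    dsimp only
    gcongr
    apply le_min
    · have h2 := Real.one_sub_sq_div_two_le_cos (x := t 0)
      have h3 := PiLp.norm_apply_le t 0
      rw [Real.norm_eq_abs] at h3
      have h4 : (t 0) ^ 2 ≤ ‖t‖ ^ 2 := by
        rw [← sq_abs]; gcongr
      nlinarith [sq_nonneg (t 0)]
    · linarith [Real.neg_one_le_cos (t 0)]

lemma A_pos (m : ℕ) {α : ℝ} (hα : α ∈ Set.Ioo (0 : ℝ) 1) : 0 < ∫ t, Ak m α t := by
  rw [integral_pos_iff_support_of_nonneg (Ak_nonneg m α) (Ak_integrable m hα)]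
  have ho : IsOpen ((fun t : ES m => t 0) ⁻¹' Set.Ioo 0 1) :=
    isOpen_Ioo.preimage (coord_cont m)
  refine lt_of_lt_of_le (ho.measure_pos volume ⟨WithLp.toLp 2 (fun _ => 1 / 2), ?_⟩)
    (measure_mono ?_)
  · simp; norm_num
  · intro t ht
    have ht' : 0 < t 0 ∧ t 0 < 1 := ht
    have htn : t ≠ 0 := by
      rintro rfl
      simp at ht'
    have hn : 0 < ‖t‖ := norm_pos_iff.2 htn
    rw [Function.mem_support]
    apply ne_of_gt
    unfold Ak
    have hc : Real.cos (t 0) < Real.cos 0 :=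
      Real.cos_lt_cos_of_nonneg_of_le_pi le_rfl (by linarith [Real.pi_gt_three]) ht'.1
    rw [Real.cos_zero] at hc
    apply div_pos (by linarith) (by positivity)

/-- there is a unique `λ* > 0` with `ν(λ*) = 0`; moreover `ν < 0` on
`(0,λ*)` and `ν > 0` on `(λ*,∞)`.  Here `N = m + 2 ≥ 2`. -/
theorem statement_11 (m : ℕ) (α : ℝ) (hα : α ∈ Set.Ioo (0 : ℝ) 1) :
    ∃ lamStar : ℝ, 0 < lamStar ∧ nu m α lamStar = 0 ∧
      (∀ R : ℝ, 0 < R → R < lamStar → nu m α R < 0) ∧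
      (∀ R : ℝ, lamStar < R → 0 < nu m α R) ∧
      ∀ lam' : ℝ, 0 < lam' → nu m α lam' = 0 → lam' = lamStar := by
  have hnu : ∀ R, nu m α R = 2 * R ^ (1 + α) * ((∫ t, Ak m α t) - ∫ t, Bk m α R t) :=
    fun R => rfl
  have hA := A_pos m hα
  obtain ⟨a, ha, haB⟩ := B_large m hα.1 (∫ t, Ak m α t)
  obtain ⟨b, hbB, hab⟩ :=
    (((B_tendsto m hα.1).eventually_lt_const hA).and (eventually_ge_atTop a)).exists
  obtain ⟨l, hl, hl0⟩ : ∃ l ∈ Set.Icc a b, ∫ t, Bk m α l t = ∫ t, Ak m α t := by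
    have hco : ContinuousOn (fun R => ∫ t, Bk m α R t) (Set.Icc a b) := fun x hx =>
      (B_cont m hα.1 (ha.trans_le hx.1)).continuousWithinAt
    exact intermediate_value_Icc' hab hco ⟨hbB.le, haB.le⟩
  have hlp : 0 < l := ha.trans_le hl.1
  have hneg : ∀ R : ℝ, 0 < R → R < l → nu m α R < 0 := by
    intro R hR hRl
    rw [hnu]
    have := B_strict m hα.1 hR hRl
    apply mul_neg_of_pos_of_neg (by positivity)
    linarith
  have hpos : ∀ R : ℝ, l < R → 0 < nu m α R := by
    intro R hRl
    have hR := hlp.trans hRl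
    rw [hnu]
    have := B_strict m hα.1 hlp hRl
    apply mul_pos (by positivity)
    linarith
  refine ⟨l, hlp, by rw [hnu, hl0]; simp, hneg, hpos, ?_⟩
  intro x hx hx0
  rcases lt_trichotomy x l with h | h | h
  · exact absurd hx0 (hneg x hx h).ne
  · exact h
  · exact absurd hx0 (hpos x h).ne'
end
end

section
/- Let N ≥ 2, α ∈ (0,1), β ∈ (α,1), λ* > 0 and set τ₁ := 1/(6λ*). Then there exists a constant c > 0, depending only on N, α, β and λ*, such that for every τ ∈ (−τ₁,τ₁) with τ ≠ 0 and every u : ℝ^{N-1} → ℝ of class C^{1,β} with ‖u − λ*‖_{C^{1,β}} < λ*/2, the function 𝓗(τ,u)(s) := ∑_{q∈ℤ, q≠0} ∫_{ℝ^{N-1}} ∫_{−1}^{1} u(s−t) / ( |t|² + (u(s) − u(s−t)z − q/τ)² )^{(N+α)/2} dz dt is well defined (the sum of integrals converges absolutely) and satisfies |𝓗(τ,u)(s)| ≤ c|τ|^{1+α} for all s ∈ ℝ^{N-1}, and |𝓗(τ,u)(s) − 𝓗(τ,u)(s̄)| ≤ c|τ|^{1+α}|s − s̄|^{β−α} for all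 s, s̄ ∈ ℝ^{N-1}. -/
open MeasureTheory Real Filter Topology
open scoped Classical

noncomputable section

/-- `u` is of class `C^{1,β}`. -/
def IsC1Beta {n : ℕ} (β : ℝ) (u : EuclideanSpace ℝ (Fin n) → ℝ) : Prop :=
  ContDiff ℝ 1 u ∧ (∃ C, ∀ x, |u x| ≤ C) ∧ (∃ C, ∀ x, ‖fderiv ℝ u x‖ ≤ C) ∧
    (∃ C, ∀ x y, ‖fderiv ℝ u x - fderiv ℝ u y‖ ≤ C * ‖x - y‖ ^ β)

/-- The `β`-Hölder seminorm of the gradient of `u`. -/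
def holderSemi {n : ℕ} (β : ℝ) (u : EuclideanSpace ℝ (Fin n) → ℝ) : ℝ :=
  ⨆ p : EuclideanSpace ℝ (Fin n) × EuclideanSpace ℝ (Fin n),
    if p.1 = p.2 then 0 else ‖fderiv ℝ u p.1 - fderiv ℝ u p.2‖ / ‖p.1 - p.2‖ ^ β

/-- The `C^{1,β}` norm: `sup |u| + sup |∇u| + [∇u]_β`. -/
def c1betaNorm {n : ℕ} (β : ℝ) (u : EuclideanSpace ℝ (Fin n) → ℝ) : ℝ :=
  (⨆ x, |u x|) + (⨆ x, ‖fderiv ℝ u x‖) + holderSemi β u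

lemma aux_kernel (m : ℕ) (α : ℝ) (hα : 0 < α) :
    ∃ K : ℝ, 0 ≤ K ∧ ∀ A : ℝ, 0 < A →
      Integrable (fun t : ES m => (‖t‖ ^ 2 + A ^ 2) ^ (-(((m : ℝ) + 2 + α) / 2))) ∧
      ∫ t : ES m, (‖t‖ ^ 2 + A ^ 2) ^ (-(((m : ℝ) + 2 + α) / 2)) = K * A ^ (-(1 + α)) := by
  set r : ℝ := (m : ℝ) + 2 + α with hr
  have hint : Integrable (fun t : ES m => ((1 : ℝ) + ‖t‖ ^ 2) ^ (-r / 2)) := by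
    apply integrable_rpow_neg_one_add_norm_sq
    simp [hr]
    linarith
  refine ⟨∫ t : ES m, ((1 : ℝ) + ‖t‖ ^ 2) ^ (-r / 2), integral_nonneg fun t => by positivity, ?_⟩
  intro A hA
  have heq : (fun t : ES m => (‖t‖ ^ 2 + A ^ 2) ^ (-(r / 2))) =
      fun t : ES m => A ^ (-r) * ((1 : ℝ) + ‖A⁻¹ • t‖ ^ 2) ^ (-r / 2) := by
    funext t
    have h1 : ‖t‖ ^ 2 + A ^ 2 = A ^ 2 * (1 + ‖A⁻¹ • t‖ ^ 2) := by
      rw [norm_smul, Real.norm_eq_abs, abs_of_pos (inv_pos.mpr hA)]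
      field_simp
      ring
    rw [h1, Real.mul_rpow (by positivity) (by positivity), ← Real.rpow_natCast A 2,
      ← Real.rpow_mul hA.le]
    congr 1
    · congr 1
      push_cast
      ring
    · congr 1
      ring
  rw [heq]
  refine ⟨(hint.comp_smul (inv_ne_zero hA.ne')).const_mul _, ?_⟩
  rw [integral_const_mul, Measure.integral_comp_smul volume
    (fun t : ES m => ((1 : ℝ) + ‖t‖ ^ 2) ^ (-r / 2))]
  have h2 : A ^ (-r) * |((A⁻¹) ^ (m + 1))⁻¹| = A ^ (-(1 + α)) := by
    rw [abs_of_pos (by positivity), inv_pow, inv_inv, ← Real.rpow_natCast A (m + 1),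
      ← Real.rpow_add hA]
    congr 1
    rw [hr]
    push_cast
    ring
  simp only [finrank_euclideanSpace, Fintype.card_fin, smul_eq_mul]
  rw [← mul_assoc, h2]
  ring

lemma aux_int (m : ℕ) (k : ES m → ℝ) (hk : Integrable k) (C : ℝ) (g : ES m × ℝ → ℝ)
    (hg : Measurable g) (hb : ∀ t : ES m, ∀ z ∈ Set.Ioo (-1 : ℝ) 1, |g (t, z)| ≤ C * k t) :
    IntegrableOn g (Set.univ ×ˢ Set.Ioo (-1 : ℝ) 1) ∧
    Integrable g (volume.prod (volume.restrict (Set.Ioo (-1 : ℝ) 1))) ∧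
    |∫ t : ES m, ∫ z in Set.Ioo (-1 : ℝ) 1, g (t, z)| ≤ 2 * C * ∫ t, k t := by
  set μ := (volume.restrict (Set.Ioo (-1 : ℝ) 1)) with hμ
  have hres : (volume : Measure (ES m × ℝ)).restrict (Set.univ ×ˢ Set.Ioo (-1 : ℝ) 1)
      = volume.prod μ := by
    rw [Measure.volume_eq_prod, ← Measure.prod_restrict, Measure.restrict_univ]
  have hK : Integrable (fun p : ES m × ℝ => C * k p.1) ((volume : Measure (ES m)).prod μ) :=
    (hk.comp_fst μ).const_mul C
  have hae : ∀ᵐ p ∂((volume : Measure (ES m)).prod μ), ‖g p‖ ≤ C * k p.1 := by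
    rw [← hres]
    refine (ae_restrict_iff' (MeasurableSet.univ.prod measurableSet_Ioo)).mpr
      (Filter.Eventually.of_forall ?_)
    rintro ⟨t, z⟩ ⟨_, hz⟩
    exact hb t z hz
  have hI : Integrable g ((volume : Measure (ES m)).prod μ) :=
    hK.mono' hg.aestronglyMeasurable hae
  refine ⟨?_, hI, ?_⟩
  · rw [IntegrableOn, hres]; exact hI
  · rw [← integral_prod _ hI]
    have := norm_integral_le_of_norm_le hK hae
    rw [integral_prod _ hK] at this
    refine this.trans (le_of_eq ?_)
    simp [integral_const_mul, hμ]
    rw [← mul_assoc]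
    norm_num

lemma aux_lip (T A p x y : ℝ) (hT : 0 ≤ T) (hA : 0 < A) (hp : 0 < p) (hx : A ≤ x) (hy : A ≤ y) :
    |(T + x ^ 2) ^ (-p) - (T + y ^ 2) ^ (-p)| ≤ (2 * p / A * (T + A ^ 2) ^ (-p)) * |x - y| := by
  have hd : ∀ w ∈ Set.Ici A, HasDerivWithinAt (fun w : ℝ => (T + w ^ 2) ^ (-p))
      ((2 * w) * (-p) * (T + w ^ 2) ^ (-p - 1)) (Set.Ici A) w := by
    intro w hw
    have hw0 : 0 < w := hA.trans_le hw
    have h1 : HasDerivAt (fun w : ℝ => T + w ^ 2) (2 * w) w := by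
      simpa using (hasDerivAt_pow 2 w).const_add T
    exact (h1.rpow_const (Or.inl (by positivity))).hasDerivWithinAt
  have hbd : ∀ w ∈ Set.Ici A, ‖(2 * w) * (-p) * (T + w ^ 2) ^ (-p - 1)‖
      ≤ 2 * p / A * (T + A ^ 2) ^ (-p) := by
    intro w hw
    have hw' : A ≤ w := hw
    have hw0 : 0 < w := hA.trans_le hw
    have hpos : 0 < T + w ^ 2 := by positivity
    rw [Real.rpow_sub_one hpos.ne']
    have e : ‖(2 * w) * (-p) * ((T + w ^ 2) ^ (-p) / (T + w ^ 2))‖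
        = 2 * p * (w / (T + w ^ 2)) * (T + w ^ 2) ^ (-p) := by
      rw [Real.norm_eq_abs, show (2 * w) * (-p) * ((T + w ^ 2) ^ (-p) / (T + w ^ 2))
        = -(2 * p * (w / (T + w ^ 2)) * (T + w ^ 2) ^ (-p)) by ring, abs_neg, abs_of_nonneg]
      positivity
    rw [e]
    have h1 : w / (T + w ^ 2) ≤ 1 / A := by
      rw [div_le_div_iff₀ hpos hA]
      nlinarith
    have h2 : (T + w ^ 2) ^ (-p) ≤ (T + A ^ 2) ^ (-p) := by
      apply Real.rpow_le_rpow_of_nonpos (by positivity) _ (by linarith)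
      gcongr
    calc _ ≤ 2 * p * (1 / A) * (T + A ^ 2) ^ (-p) := by gcongr
      _ = _ := by ring
  have := (convex_Ici A).norm_image_sub_le_of_norm_hasDerivWithin_le hd hbd hy hx
  simpa [Real.norm_eq_abs] using this

lemma aux_bd (T A p x b B : ℝ) (hT : 0 ≤ T) (hA : 0 < A) (hp : 0 < p) (hx : A ≤ |x|)
    (hb : |b| ≤ B) : |b / (T + x ^ 2) ^ p| ≤ B * (T + A ^ 2) ^ (-p) := by
  have hx2 : A ^ 2 ≤ x ^ 2 := by rw [← sq_abs x]; gcongr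
  have hpos : 0 < T + A ^ 2 := by positivity
  rw [div_eq_mul_inv, ← Real.rpow_neg (by positivity), abs_mul,
    abs_of_nonneg (a := (T + x ^ 2) ^ (-p)) (by positivity)]
  have h2 : (T + x ^ 2) ^ (-p) ≤ (T + A ^ 2) ^ (-p) :=
    Real.rpow_le_rpow_of_nonpos (by positivity) (by linarith) (by linarith)
  have : 0 ≤ B := (abs_nonneg b).trans hb
  gcongr

lemma aux_diff (T A p x y b b' B D E : ℝ) (hT : 0 ≤ T) (hA : 0 < A) (hp : 0 < p)
    (hx : A ≤ |x|) (hy : A ≤ |y|) (hb' : |b'| ≤ B) (hD : |b - b'| ≤ D) (hE : |x - y| ≤ E) :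
    |b / (T + x ^ 2) ^ p - b' / (T + y ^ 2) ^ p|
      ≤ (D + B * (2 * p / A) * E) * (T + A ^ 2) ^ (-p) := by
  have h1 := aux_bd T A p x (b - b') D hT hA hp hx hD
  have h2 := aux_lip T A p |x| |y| hT hA hp hx hy
  rw [sq_abs, sq_abs] at h2
  have h3 : |(|x| - |y|)| ≤ E := (abs_abs_sub_abs_le_abs_sub x y).trans hE
  have e : b / (T + x ^ 2) ^ p - b' / (T + y ^ 2) ^ p = (b - b') / (T + x ^ 2) ^ p
      + b' * ((T + x ^ 2) ^ (-p) - (T + y ^ 2) ^ (-p)) := by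
    rw [Real.rpow_neg (by positivity), Real.rpow_neg (by positivity)]
    ring
  rw [e]
  refine (abs_add_le _ _).trans ?_
  rw [abs_mul]
  have hB : 0 ≤ B := (abs_nonneg b').trans hb'
  calc _ ≤ D * (T + A ^ 2) ^ (-p) + B * ((2 * p / A * (T + A ^ 2) ^ (-p)) * E) := by
        gcongr
        exact h2.trans (by gcongr)
    _ = _ := by ring

lemma aux_u (n : ℕ) (β l : ℝ) (u : EuclideanSpace ℝ (Fin n) → ℝ)
    (hu : IsC1Beta β u) (h : c1betaNorm β (fun x => u x - l) < l / 2) :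
    (∀ x, |u x - l| ≤ l / 2) ∧ ∀ x y, |u x - u y| ≤ l / 2 * ‖x - y‖ := by
  obtain ⟨hc, ⟨C, hC⟩, ⟨C1, hC1⟩, -⟩ := hu
  unfold c1betaNorm at h
  have h0 : 0 ≤ holderSemi β (fun x => u x - l) := by
    apply Real.iSup_nonneg
    intro p
    split_ifs
    · exact le_rfl
    · positivity
  have hf : ∀ x, fderiv ℝ (fun x => u x - l) x = fderiv ℝ u x := fun x => fderiv_sub_const l
  simp only [hf] at h
  have h1 : ∀ x, |u x - l| ≤ ⨆ x, |u x - l| := fun x => le_ciSup (f := fun x => |u x - l|)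
    ⟨C + |l|, by rintro _ ⟨x, rfl⟩; exact (abs_sub _ _).trans (by linarith [hC x])⟩ x
  have h2 : ∀ x, ‖fderiv ℝ u x‖ ≤ ⨆ x, ‖fderiv ℝ u x‖ := fun x =>
    le_ciSup (f := fun x => ‖fderiv ℝ u x‖) ⟨C1, by rintro _ ⟨x, rfl⟩; exact hC1 x⟩ x
  have h3 := (abs_nonneg _).trans (h1 0)
  have h4 := (norm_nonneg _).trans (h2 0)
  refine ⟨fun x => (h1 x).trans (by linarith), fun x y => ?_⟩
  exact convex_univ.norm_image_sub_le_of_norm_fderiv_le (𝕜 := ℝ)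
    (fun x _ => (hc.differentiable one_ne_zero) x)
    (fun x _ => (h2 x).trans (by linarith)) (Set.mem_univ y) (Set.mem_univ x)

lemma aux_far (l τ a b z : ℝ) (q : ℤ) (hq : q ≠ 0) (hl : 0 < l) (hτ : τ ≠ 0)
    (hτ1 : |τ| < 1 / (6 * l)) (ha : |a - l| ≤ l / 2) (hb : |b - l| ≤ l / 2)
    (hz : z ∈ Set.Ioo (-1 : ℝ) 1) :
    |(q : ℝ)| / (2 * |τ|) ≤ |a - b * z - q / τ| := by
  have ht : 0 < |τ| := abs_pos.mpr hτ
  have hq1 : (1 : ℝ) ≤ |(q : ℝ)| := by exact_mod_cast Int.one_le_abs hq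
  have h3 : 3 * l ≤ |(q : ℝ)| / (2 * |τ|) := by
    rw [lt_div_iff₀ (by positivity)] at hτ1
    rw [le_div_iff₀ (by positivity)]
    nlinarith
  have hz1 : |z| ≤ 1 := abs_le.mpr ⟨hz.1.le, hz.2.le⟩
  have ha' : |a| ≤ 3 * l / 2 := by
    rw [abs_le] at *; constructor <;> linarith
  have hb' : |b| ≤ 3 * l / 2 := by
    rw [abs_le] at *; constructor <;> linarith
  have hbz : |b * z| ≤ 3 * l / 2 := by
    rw [abs_mul]; nlinarith [abs_nonneg b, abs_nonneg z]
  have h4 : |a - b * z| ≤ 3 * l := (abs_sub _ _).trans (by linarith)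
  have h5 : |(q : ℝ) / τ| = 2 * (|(q : ℝ)| / (2 * |τ|)) := by
    rw [abs_div]; field_simp
  have h6 := abs_sub_abs_le_abs_sub ((q : ℝ) / τ) (a - b * z)
  rw [abs_sub_comm ((q : ℝ) / τ) (a - b * z)] at h6
  linarith

lemma aux_theta (l θ δ d : ℝ) (hl : 0 < l) (h0 : 0 < θ) (h1 : θ ≤ 1) (hδ : 0 ≤ δ)
    (hd : d ≤ l / 2 * δ) (hd' : d ≤ l) : d ≤ l * δ ^ θ := by
  rcases le_total δ 1 with h | h
  · have : δ ≤ δ ^ θ := by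
      simpa using Real.rpow_le_rpow_of_exponent_ge_of_imp hδ h h1 (fun _ => by simp)
    nlinarith
  · have := Real.one_le_rpow h h0.le
    nlinarith

/-- uniform bounds for the operator
`𝓗(τ,u)(s) = ∑_{q ≠ 0} ∫∫ u(s-t)/(|t|² + (u(s) - u(s-t)z - q/τ)²)^{(N+α)/2} dz dt`:
it is well defined (the integrals and the sum converge absolutely) and satisfies
`|𝓗(τ,u)(s)| ≤ c|τ|^{1+α}` and `|𝓗(τ,u)(s) - 𝓗(τ,u)(s̄)| ≤ c|τ|^{1+α}|s-s̄|^{β-α}`,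
for all `τ ∈ (-τ₁,τ₁) \ {0}` (`τ₁ = 1/(6λ*)`) and all `u` with `‖u - λ*‖_{C^{1,β}} < λ*/2`.
Here `N = m + 2 ≥ 2`. -/
theorem statement_14 (m : ℕ) (α β lamStar : ℝ) (hα : α ∈ Set.Ioo (0 : ℝ) 1)
    (hβ : β ∈ Set.Ioo α 1) (hl : 0 < lamStar) :
    ∃ c > 0, ∀ τ : ℝ, τ ≠ 0 → |τ| < 1 / (6 * lamStar) →
      ∀ u : ES m → ℝ, IsC1Beta β u →
        c1betaNorm β (fun x => u x - lamStar) < lamStar / 2 →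
        (∀ (s : ES m) (q : ℤ), q ≠ 0 →
          IntegrableOn
            (fun p : ES m × ℝ =>
              u (s - p.1) /
                (‖p.1‖ ^ 2 + (u s - u (s - p.1) * p.2 - q / τ) ^ 2) ^ (((m : ℝ) + 2 + α) / 2))
            (Set.univ ×ˢ Set.Ioo (-1 : ℝ) 1)) ∧
        (∀ s : ES m, Summable (fun q : {q : ℤ // q ≠ 0} =>
          ∫ t : ES m, ∫ z in Set.Ioo (-1 : ℝ) 1,
            |u (s - t) /
              (‖t‖ ^ 2 + (u s - u (s - t) * z - (q : ℤ) / τ) ^ 2) ^ (((m : ℝ) + 2 + α) / 2)|)) ∧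
        (∀ s : ES m,
          |∑' q : {q : ℤ // q ≠ 0},
              ∫ t : ES m, ∫ z in Set.Ioo (-1 : ℝ) 1,
                u (s - t) /
                  (‖t‖ ^ 2 + (u s - u (s - t) * z - (q : ℤ) / τ) ^ 2) ^ (((m : ℝ) + 2 + α) / 2)|
            ≤ c * |τ| ^ (1 + α)) ∧
        ∀ s sbar : ES m,
          |(∑' q : {q : ℤ // q ≠ 0},
              ∫ t : ES m, ∫ z in Set.Ioo (-1 : ℝ) 1,
                u (s - t) /
                  (‖t‖ ^ 2 + (u s - u (s - t) * z - (q : ℤ) / τ) ^ 2) ^ (((m : ℝ) + 2 + α) / 2)) -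
            ∑' q : {q : ℤ // q ≠ 0},
              ∫ t : ES m, ∫ z in Set.Ioo (-1 : ℝ) 1,
                u (sbar - t) /
                  (‖t‖ ^ 2 + (u sbar - u (sbar - t) * z - (q : ℤ) / τ) ^ 2) ^ (((m : ℝ) + 2 + α) / 2)|
            ≤ c * |τ| ^ (1 + α) * ‖s - sbar‖ ^ (β - α) := by
  obtain ⟨hα0, hα1⟩ := hα
  obtain ⟨hβα, hβ1⟩ := hβ
  obtain ⟨K, hK0, hK⟩ := aux_kernel m α hα0
  set p : ℝ := ((m : ℝ) + 2 + α) / 2 with hp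
  have hp0 : 0 < p := by rw [hp]; positivity
  have hS : Summable (fun q : {q : ℤ // q ≠ 0} => |((q : ℤ) : ℝ)| ^ (-(1 + α))) :=
    (Real.summable_abs_int_rpow (by linarith : 1 < 1 + α)).subtype _
  set S : ℝ := ∑' q : {q : ℤ // q ≠ 0}, |((q : ℤ) : ℝ)| ^ (-(1 + α)) with hSdef
  have hS0 : 0 ≤ S := tsum_nonneg fun q => by positivity
  set c0 : ℝ := 2 * K * 2 ^ (1 + α) * S with hc0
  have hc00 : 0 ≤ c0 := by positivity
  set B : ℝ := 3 * lamStar / 2 with hB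
  set M : ℝ := lamStar * (1 + 2 * p) with hM
  have hB0 : 0 < B := by positivity
  have hM0 : 0 < M := by positivity
  refine ⟨c0 * (B + M) + 1, by positivity, ?_⟩
  intro τ hτ hτ1 u hu hnorm
  obtain ⟨hu1, hu2⟩ := aux_u _ β lamStar u hu hnorm
  have ht : 0 < |τ| := abs_pos.mpr hτ
  have hum : Measurable u := hu.1.continuous.measurable
  have huB : ∀ x, |u x| ≤ B := fun x => by
    have := hu1 x
    rw [hB]; rw [abs_le] at *; constructor <;> linarith
  have hApos : ∀ q : ℤ, q ≠ 0 → 0 < |(q : ℝ)| / (2 * |τ|) := fun q hq => by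
    have : (0 : ℝ) < |(q : ℝ)| := abs_pos.mpr (by exact_mod_cast hq)
    positivity
  have hA3 : ∀ q : ℤ, q ≠ 0 → 3 * lamStar ≤ |(q : ℝ)| / (2 * |τ|) := fun q hq => by
    have hq1 : (1 : ℝ) ≤ |(q : ℝ)| := by exact_mod_cast Int.one_le_abs hq
    rw [lt_div_iff₀ (by positivity)] at hτ1
    rw [le_div_iff₀ (by positivity)]
    nlinarith
  have hApow : ∀ q : ℤ, (|(q : ℝ)| / (2 * |τ|)) ^ (-(1 + α))
      = 2 ^ (1 + α) * |τ| ^ (1 + α) * |(q : ℝ)| ^ (-(1 + α)) := fun q => by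
    rw [Real.div_rpow (by positivity) (by positivity), Real.rpow_neg (x := 2 * |τ|) (by positivity),
      Real.mul_rpow (by positivity) (by positivity), div_inv_eq_mul]
    ring
  -- the integrand
  set f : ES m → ℤ → ES m × ℝ → ℝ := fun s q x => u (s - x.1) /
    (‖x.1‖ ^ 2 + (u s - u (s - x.1) * x.2 - q / τ) ^ 2) ^ p with hf
  have hfm : ∀ s q, Measurable (f s q) := fun s q => by
    rw [hf]
    have : Measurable (fun x : ES m × ℝ => u (s - x.1)) :=
      hum.comp (measurable_const.sub measurable_fst)
    fun_prop
  have hfb : ∀ s q, q ≠ 0 → ∀ t : ES m, ∀ z ∈ Set.Ioo (-1 : ℝ) 1,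
      |f s q (t, z)| ≤ B * (‖t‖ ^ 2 + (|(q : ℝ)| / (2 * |τ|)) ^ 2) ^ (-p) := by
    intro s q hq t z hz
    exact aux_bd _ _ p _ _ B (by positivity) (hApos q hq) hp0
      (aux_far lamStar τ _ _ z q hq hl hτ hτ1 (hu1 _) (hu1 _) hz) (huB _)
  -- general estimate
  have key : ∀ q : ℤ, q ≠ 0 → ∀ (C : ℝ) (g : ES m × ℝ → ℝ), Measurable g →
      (∀ t : ES m, ∀ z ∈ Set.Ioo (-1 : ℝ) 1,
        |g (t, z)| ≤ C * (‖t‖ ^ 2 + (|(q : ℝ)| / (2 * |τ|)) ^ 2) ^ (-p)) →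
      IntegrableOn g (Set.univ ×ˢ Set.Ioo (-1 : ℝ) 1) ∧
      Integrable g (volume.prod (volume.restrict (Set.Ioo (-1 : ℝ) 1))) ∧
      |∫ t : ES m, ∫ z in Set.Ioo (-1 : ℝ) 1, g (t, z)|
        ≤ (2 * K * 2 ^ (1 + α) * (C * |τ| ^ (1 + α))) * |(q : ℝ)| ^ (-(1 + α)) := by
    intro q hq C g hg hb
    obtain ⟨hi, hv⟩ := hK _ (hApos q hq)
    obtain ⟨h1, h2, h3⟩ := aux_int m _ hi C g hg hb
    refine ⟨h1, h2, h3.trans (le_of_eq ?_)⟩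
    rw [hv, hApow]
    ring
  have hsumI : ∀ (C : ℝ) (I : {q : ℤ // q ≠ 0} → ℝ), (∀ q, |I q| ≤
      (2 * K * 2 ^ (1 + α) * (C * |τ| ^ (1 + α))) * |((q : ℤ) : ℝ)| ^ (-(1 + α))) →
      Summable I ∧ |∑' q, I q| ≤ c0 * C * |τ| ^ (1 + α) := by
    intro C I hI
    have hs := hS.mul_left (2 * K * 2 ^ (1 + α) * (C * |τ| ^ (1 + α)))
    refine ⟨Summable.of_norm_bounded hs hI, ?_⟩
    have := tsum_of_norm_bounded (f := I) hs.hasSum hI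
    rw [tsum_mul_left] at this
    refine this.trans (le_of_eq ?_)
    rw [hc0]
    ring
  have hτp : 0 < |τ| ^ (1 + α) := by positivity
  have hsum : ∀ s : ES m, Summable (fun q : {q : ℤ // q ≠ 0} =>
      ∫ t : ES m, ∫ z in Set.Ioo (-1 : ℝ) 1, f s q (t, z)) ∧ _ := fun s =>
    hsumI B _ (fun q => (key q q.2 B (f s q) (hfm s q) (hfb s q q.2)).2.2)
  refine ⟨fun s q hq => (key q hq B (f s q) (hfm s q) (hfb s q hq)).1, fun s => ?_,
    fun s => ?_, fun s s' => ?_⟩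
  · refine (hsumI B _ (fun q => (key q q.2 B (fun x => |f s q x|) ?_ ?_).2.2)).1
    · exact (hfm s q).abs
    · intro t z hz
      rw [abs_abs]
      exact hfb s q q.2 t z hz
  · refine (hsum s).2.trans ?_
    gcongr
    nlinarith
  · have hδ : 0 ≤ ‖s - s'‖ ^ (β - α) := by positivity
    have hux : ∀ x y, |u x - u y| ≤ lamStar * ‖x - y‖ ^ (β - α) := fun x y =>
      aux_theta lamStar (β - α) ‖x - y‖ _ hl (by linarith) (by linarith) (norm_nonneg _)
        (hu2 x y) (by
          have h1 := hu1 x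
          have h2 := hu1 y
          rw [abs_le] at *; constructor <;> linarith)
    have hdiff : ∀ q : ℤ, q ≠ 0 → ∀ t : ES m, ∀ z ∈ Set.Ioo (-1 : ℝ) 1,
        |f s q (t, z) - f s' q (t, z)| ≤ (M * ‖s - s'‖ ^ (β - α)) *
          (‖t‖ ^ 2 + (|(q : ℝ)| / (2 * |τ|)) ^ 2) ^ (-p) := by
      intro q hq t z hz
      have hA := hApos q hq
      have hz1 : |z| ≤ 1 := abs_le.mpr ⟨hz.1.le, hz.2.le⟩
      have hD : |u (s - t) - u (s' - t)| ≤ lamStar * ‖s - s'‖ ^ (β - α) := by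
        simpa using hux (s - t) (s' - t)
      have hE : |(u s - u (s - t) * z - q / τ) - (u s' - u (s' - t) * z - q / τ)|
          ≤ 2 * (lamStar * ‖s - s'‖ ^ (β - α)) := by
        have e : (u s - u (s - t) * z - q / τ) - (u s' - u (s' - t) * z - q / τ)
          = (u s - u s') - (u (s - t) - u (s' - t)) * z := by ring
        rw [e]
        refine (abs_sub _ _).trans ?_
        rw [abs_mul]
        have := hux s s'
        nlinarith [abs_nonneg z, abs_nonneg (u (s - t) - u (s' - t))]
      refine (aux_diff (‖t‖ ^ 2) _ p _ _ _ _ B _ _ (by positivity) hA hp0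
        (aux_far lamStar τ _ _ z q hq hl hτ hτ1 (hu1 _) (hu1 _) hz)
        (aux_far lamStar τ _ _ z q hq hl hτ hτ1 (hu1 _) (hu1 _) hz) (huB _) hD hE).trans ?_
      apply mul_le_mul_of_nonneg_right _ (by positivity)
      have h1 : 2 * p / (|(q : ℝ)| / (2 * |τ|)) ≤ 2 * p / (3 * lamStar) := by
        have := hA3 q hq
        gcongr
      calc lamStar * ‖s - s'‖ ^ (β - α) + B * (2 * p / (|(q : ℝ)| / (2 * |τ|))) *
            (2 * (lamStar * ‖s - s'‖ ^ (β - α)))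
          ≤ lamStar * ‖s - s'‖ ^ (β - α) + B * (2 * p / (3 * lamStar)) *
            (2 * (lamStar * ‖s - s'‖ ^ (β - α))) := by gcongr
        _ = _ := by
          rw [hM, hB]; field_simp
    have hfin := hsumI (M * ‖s - s'‖ ^ (β - α)) _ (fun q => (key q q.2 _
      (fun x => f s q x - f s' q x) ((hfm s q).sub (hfm s' q)) (hdiff q q.2)).2.2)
    have hsub : ∀ q : {q : ℤ // q ≠ 0},
        (∫ t : ES m, ∫ z in Set.Ioo (-1 : ℝ) 1, (f s q (t, z) - f s' q (t, z))) =
        (∫ t : ES m, ∫ z in Set.Ioo (-1 : ℝ) 1, f s q (t, z)) -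
        ∫ t : ES m, ∫ z in Set.Ioo (-1 : ℝ) 1, f s' q (t, z) := fun q => 
      integral_integral_sub (key q q.2 B (f s q) (hfm s q) (hfb s q q.2)).2.1
        (key q q.2 B (f s' q) (hfm s' q) (hfb s' q q.2)).2.1
    have h2 := hfin.2
    simp only [hsub] at h2
    rw [(hsum s).1.tsum_sub (hsum s').1] at h2
    refine h2.trans ?_
    have : c0 * M ≤ c0 * (B + M) + 1 := by nlinarith
    calc c0 * (M * ‖s - s'‖ ^ (β - α)) * |τ| ^ (1 + α)
        = (c0 * M) * |τ| ^ (1 + α) * ‖s - s'‖ ^ (β - α) := by ring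
      _ ≤ _ := by gcongr
end
end

section
/- Let N ≥ 2, α ∈ (0,1), β ∈ (α,1), let u : ℝ^{N-1} → ℝ be of class C^{1,β} with inf u > 0, and let v : ℝ^{N-1} → ℝ be of class C^{1,β}. Then for every s ∈ ℝ^{N-1}, the directional derivative lim_{ς→0} ( H(u + ςv)(s) − H(u)(s) ) / ς exists and equals 2 lim_{ε→0⁺} ∫_{{t : |t| ≥ ε}} (v(s) − v(s−t)) / ( |t|² + (u(s) − u(s−t))² )^{(N+α)/2} dt − 2 ∫_{ℝ^{N-1}} (v(s) + v(s−t)) / ( |t|² + (u(s) + u(s−t))² )^{(N+α)/2} dt, where the first limit (a principal value) exists and the second integral converges absolutely. -/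
open MeasureTheory Real Filter Topology

noncomputable section

/-- The nonlocal mean curvature operator `H(u)(s)` in graph form (`N = m + 2`). -/
def Hop (m : ℕ) (α : ℝ) (u : ES m → ℝ) (s : ES m) : ℝ :=
  -(2 / α) *
    ((∫ t : ES m, (u s - u (s - t) - fderiv ℝ u (s - t) t) /
        (‖t‖ ^ 2 + (u s - u (s - t)) ^ 2) ^ (((m : ℝ) + 2 + α) / 2)) -
      ∫ t : ES m, (u s + u (s - t) + fderiv ℝ u (s - t) t) /
        (‖t‖ ^ 2 + (u s + u (s - t)) ^ 2) ^ (((m : ℝ) + 2 + α) / 2))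


/-- the integrand of the derivative -/
def Dk {m : ℕ} (p : ℝ) (a : ES m → ℝ) (a' : ES m → ES m →L[ℝ] ℝ) (b : ES m → ℝ)
    (b' : ES m → ES m →L[ℝ] ℝ) (t : ES m) : ℝ :=
  (b t - b' t t) / (‖t‖ ^ 2 + a t ^ 2) ^ p -
    2 * p * ((a t - a' t t) * (a t * b t)) / (‖t‖ ^ 2 + a t ^ 2) ^ (p + 1)

theorem scalar_deriv (p x y X Y T c : ℝ) (hK : 0 < T + (x + c * y) ^ 2) :
    HasDerivAt (fun c : ℝ => ((x + c * y) - (X + c * Y)) / (T + (x + c * y) ^ 2) ^ p)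
      ((y - Y) / (T + (x + c * y) ^ 2) ^ p -
        2 * p * (((x + c * y) - (X + c * Y)) * ((x + c * y) * y)) /
          (T + (x + c * y) ^ 2) ^ (p + 1)) c := by
  have e1 : HasDerivAt (fun c : ℝ => x + c * y) y c := by
    simpa using ((hasDerivAt_id c).mul_const y).const_add x
  have e2 : HasDerivAt (fun c : ℝ => X + c * Y) Y c := by
    simpa using ((hasDerivAt_id c).mul_const Y).const_add X
  have e3 : HasDerivAt (fun c : ℝ => T + (x + c * y) ^ 2) (2 * (x + c * y) * y) c := by
    refine ((e1.pow 2).const_add T).congr_deriv ?_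
    simp
  have e4 := e3.rpow_const (p := p) (Or.inl hK.ne')
  have hZ := Real.rpow_pos_of_pos hK p
  refine ((e1.sub e2).div e4 hZ.ne').congr_deriv ?_
  rw [Real.rpow_sub_one hK.ne', Real.rpow_add_one hK.ne']
  simp only [Pi.sub_apply]
  generalize (T + (x + c * y) ^ 2) ^ p = Z at *
  generalize T + (x + c * y) ^ 2 = K at *
  field_simp

theorem radial_deriv {m : ℕ} (p : ℝ) (a : ES m → ℝ) (a' : ES m → ES m →L[ℝ] ℝ) (b : ES m → ℝ)
    (b' : ES m → ES m →L[ℝ] ℝ) (ha : ∀ t, HasFDerivAt a (a' t) t)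
    (hb : ∀ t, HasFDerivAt b (b' t) t) (t : ES m) (ht : t ≠ 0) :
    HasDerivAt (fun l : ℝ => b (l • t) / (‖l • t‖ ^ 2 + a (l • t) ^ 2) ^ p)
      ((1 - 2 * p) * (b t / (‖t‖ ^ 2 + a t ^ 2) ^ p) - Dk p a a' b b' t) 1 := by
  have hl : HasDerivAt (fun l : ℝ => l • t) t 1 := by
    simpa using (hasDerivAt_id (1 : ℝ)).smul_const t
  have e1 : HasDerivAt (fun l : ℝ => a (l • t)) (a' t t) 1 := by
    have : HasFDerivAt a (a' t) ((1 : ℝ) • t) := by simpa using ha t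
    exact this.comp_hasDerivAt 1 hl
  have e2 : HasDerivAt (fun l : ℝ => b (l • t)) (b' t t) 1 := by
    have : HasFDerivAt b (b' t) ((1 : ℝ) • t) := by simpa using hb t
    exact this.comp_hasDerivAt 1 hl
  have hT : 0 < ‖t‖ := norm_pos_iff.2 ht
  have e3 : HasDerivAt (fun l : ℝ => ‖l • t‖ ^ 2 + a (l • t) ^ 2)
      (2 * ‖t‖ ^ 2 + 2 * a t * a' t t) 1 := by
    have q : HasDerivAt (fun l : ℝ => ‖l • t‖ ^ 2) (2 * ‖t‖ ^ 2) 1 := by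
      have : HasDerivAt (fun l : ℝ => l ^ 2 * ‖t‖ ^ 2) (2 * ‖t‖ ^ 2) 1 := by
        refine ((hasDerivAt_pow 2 (1 : ℝ)).mul_const _).congr_deriv ?_
        simp
      refine this.congr_of_eventuallyEq (Eventually.of_forall fun l => ?_)
      simp [norm_smul, mul_pow]
    refine (q.add (e1.pow 2)).congr_deriv ?_
    simp
  have hK : 0 < ‖t‖ ^ 2 + a t ^ 2 := by positivity
  have e4 := e3.rpow_const (p := p) (Or.inl (by simpa using hK.ne'))
  have hZ := Real.rpow_pos_of_pos hK p
  refine (e2.div e4 (by simpa using hZ.ne')).congr_deriv ?_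
  unfold Dk
  simp only [one_smul]
  rw [Real.rpow_sub_one hK.ne', Real.rpow_add_one hK.ne']
  generalize (‖t‖ ^ 2 + a t ^ 2) ^ p = Z at *
  have hT2 : ‖t‖ ^ 2 = (‖t‖ ^ 2 + a t ^ 2) - a t ^ 2 := by ring
  generalize hKK : ‖t‖ ^ 2 + a t ^ 2 = K at *
  rw [hT2]
  field_simp
  ring

theorem kernel_meas {m : ℕ} (p : ℝ) {N a : ES m → ℝ} (hN : Continuous N) (ha : Continuous a) :
    Measurable fun t : ES m => N t / (‖t‖ ^ 2 + a t ^ 2) ^ p := by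
  have := hN.measurable
  have := ha.measurable
  fun_prop

theorem Dk_meas {m : ℕ} (p : ℝ) (a : ES m → ℝ) (a' : ES m → ES m →L[ℝ] ℝ) (b : ES m → ℝ)
    (b' : ES m → ES m →L[ℝ] ℝ) (ha : Continuous a) (ha' : Continuous a') (hb : Continuous b)
    (hb' : Continuous b') : Measurable (Dk p a a' b b') := by
  unfold Dk
  exact (kernel_meas p (N := fun t => b t - b' t t) (by fun_prop) ha).sub
    (kernel_meas (p + 1) (N := fun t => 2 * p * ((a t - a' t t) * (a t * b t))) (by fun_prop) ha)

theorem deriv_int {m : ℕ} (p : ℝ) (hp : 0 < p) (a : ES m → ℝ) (a' : ES m → ES m →L[ℝ] ℝ) (b : ES m → ℝ)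
    (b' : ES m → ES m →L[ℝ] ℝ) (ha : Continuous a) (ha' : Continuous a') (hb : Continuous b)
    (hb' : Continuous b') (C r : ℝ) (hC : 0 ≤ C) (hr : 0 < r) (hr1 : r ≤ 1) (w k : ES m → ℝ)
    (hA : ∀ t, |a t - a' t t| ≤ C * w t) (hB : ∀ t, |b t - b' t t| ≤ C * w t)
    (hk0 : ∀ t, t ≠ 0 → 0 < k t)
    (hk : ∀ c : ℝ, |c| < r → ∀ t, k t ≤ ‖t‖ ^ 2 + (a t + c * b t) ^ 2)
    (hab : ∀ c : ℝ, |c| < r → ∀ t, |(a t + c * b t) * b t| ≤ C * (‖t‖ ^ 2 + (a t + c * b t) ^ 2))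
    (hw : Integrable (fun t => w t / k t ^ p)) :
    Integrable (Dk p a a' b b') ∧
    HasDerivAt (fun c : ℝ => ∫ t, ((a t + c * b t) - (a' t t + c * b' t t)) /
      (‖t‖ ^ 2 + (a t + c * b t) ^ 2) ^ p) (∫ t, Dk p a a' b b' t) 0 := by
  have h0 : ∀ᵐ t : ES m, t ≠ 0 := by simp [ae_iff]
  have hkp : ∀ c : ℝ, |c| < r → ∀ t, t ≠ 0 → ∀ x, |x| ≤ 2 * C * w t → 
      |x| / (‖t‖ ^ 2 + (a t + c * b t) ^ 2) ^ p ≤ 2 * C * (w t / k t ^ p) := by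
    intro c hc t ht x hx
    rw [← mul_div_assoc]
    have := hk0 t ht
    exact div_le_div₀ ((abs_nonneg _).trans hx) hx (Real.rpow_pos_of_pos this p)
      (Real.rpow_le_rpow this.le (hk c hc t) hp.le)
  set F' : ℝ → ES m → ℝ := fun c t => (b t - b' t t) / (‖t‖ ^ 2 + (a t + c * b t) ^ 2) ^ p -
        2 * p * (((a t + c * b t) - (a' t t + c * b' t t)) * ((a t + c * b t) * b t)) /
          (‖t‖ ^ 2 + (a t + c * b t) ^ 2) ^ (p + 1) with hF'
  have hF0 : F' 0 = Dk p a a' b b' := by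
    funext t; simp [hF', Dk]
  have hnum : ∀ c : ℝ, |c| < r → ∀ t, |(a t + c * b t) - (a' t t + c * b' t t)| ≤ 2 * C * w t := by
    intro c hc t
    have e : (a t + c * b t) - (a' t t + c * b' t t) = (a t - a' t t) + c * (b t - b' t t) := by ring
    rw [e]
    have h1 : |c * (b t - b' t t)| ≤ C * w t := by
      rw [abs_mul]
      have := mul_le_mul (hc.le.trans hr1) (hB t) (abs_nonneg _) zero_le_one
      linarith
    have := abs_add_le (a t - a' t t) (c * (b t - b' t t))
    have := hA t
    linarith
  have key := hasDerivAt_integral_of_dominated_loc_of_deriv_le (μ := (volume : Measure (ES m)))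
    (F := fun (c : ℝ) (t : ES m) => ((a t + c * b t) - (a' t t + c * b' t t)) /
      (‖t‖ ^ 2 + (a t + c * b t) ^ 2) ^ p) (F' := F') (x₀ := (0 : ℝ)) (s := Metric.ball 0 r)
    (bound := fun t => (1 + 2 * p * C) * (2 * C * (w t / k t ^ p)))
    (Metric.ball_mem_nhds 0 hr) ?_ ?_ ?_ ?_ ?_ ?_
  · rw [hF0] at key
    exact key
  · exact Eventually.of_forall fun c => (kernel_meas p (by fun_prop) (by fun_prop)).aestronglyMeasurable
  · refine (hw.const_mul (2 * C)).mono' (kernel_meas p (by fun_prop) (by fun_prop)).aestronglyMeasurable ?_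
    filter_upwards [h0] with t ht
    have h00 : |(0 : ℝ)| < r := by simpa using hr
    have hK : 0 < ‖t‖ ^ 2 + (a t + 0 * b t) ^ 2 := (hk0 t ht).trans_le (hk 0 h00 t)
    rw [Real.norm_eq_abs, abs_div, abs_of_pos (Real.rpow_pos_of_pos hK p)]
    exact hkp 0 h00 t ht _ (hnum 0 h00 t)
  · rw [hF0]
    exact (Dk_meas p a a' b b' ha ha' hb hb').aestronglyMeasurable
  · filter_upwards [h0] with t ht c hc
    have hc : |c| < r := by simpa using hc
    have hK : 0 < ‖t‖ ^ 2 + (a t + c * b t) ^ 2 := (hk0 t ht).trans_le (hk c hc t)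
    have hZ := Real.rpow_pos_of_pos hK p
    have hCw : 0 ≤ C * w t := (abs_nonneg _).trans (hA t)
    have t1 := hkp c hc t ht (b t - b' t t) ((hB t).trans (by linarith))
    have t2 := hkp c hc t ht _ (hnum c hc t)
    have t3 := hab c hc t
    simp only [hF']
    rw [Real.norm_eq_abs]
    refine (abs_sub _ _).trans ?_
    rw [Real.rpow_add_one hK.ne', abs_div, abs_div, abs_of_pos hZ, abs_of_pos (mul_pos hZ hK),
      abs_mul, abs_mul (_ - _), abs_of_pos (by positivity : 0 < 2 * p)]
    have : 2 * p * (|a t + c * b t - (a' t t + c * b' t t)| * |(a t + c * b t) * b t|) /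
        ((‖t‖ ^ 2 + (a t + c * b t) ^ 2) ^ p * (‖t‖ ^ 2 + (a t + c * b t) ^ 2))
        ≤ 2 * p * C * (|a t + c * b t - (a' t t + c * b' t t)| / (‖t‖ ^ 2 + (a t + c * b t) ^ 2) ^ p) := by
      rw [div_le_iff₀ (mul_pos hZ hK)]
      have e : 2 * p * C * (|a t + c * b t - (a' t t + c * b' t t)| / (‖t‖ ^ 2 + (a t + c * b t) ^ 2) ^ p) *
        ((‖t‖ ^ 2 + (a t + c * b t) ^ 2) ^ p * (‖t‖ ^ 2 + (a t + c * b t) ^ 2)) =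
        2 * p * (|a t + c * b t - (a' t t + c * b' t t)| * (C * (‖t‖ ^ 2 + (a t + c * b t) ^ 2))) := by
        generalize (‖t‖ ^ 2 + (a t + c * b t) ^ 2) ^ p = Z at *
        field_simp
      rw [e]
      gcongr
    have t4 := mul_le_mul_of_nonneg_left t2 (by positivity : 0 ≤ 2 * p * C)
    linarith
  · exact (hw.const_mul _).const_mul _
  · filter_upwards [h0] with t ht c hc
    have hc : |c| < r := by simpa using hc
    have hK : 0 < ‖t‖ ^ 2 + (a t + c * b t) ^ 2 := (hk0 t ht).trans_le (hk c hc t)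
    exact scalar_deriv p (a t) (b t) (a' t t) (b' t t) (‖t‖ ^ 2) c hK

theorem scaling_aux {E : Type*} [NormedAddCommGroup E] [NormedSpace ℝ E] [FiniteDimensional ℝ E]
    [MeasurableSpace E] [BorelSpace E] (μ : Measure E) [μ.IsAddHaarMeasure] [NullSingletonClass μ]
    (n : ℕ) (hn : Module.finrank ℝ E = n + 1)
    (h G : E → ℝ) (hh : Integrable h μ) (hG : Integrable G μ) (hGm : Measurable G)
    (hd : ∀ t, t ≠ 0 → HasDerivAt (fun l : ℝ => h (l • t)) (G t - (n + 1) * h t) 1) :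
    ∫ t, G t ∂μ = 0 := by
  have hd2 : ∀ t, t ≠ 0 → ∀ l : ℝ, 0 < l →
      HasDerivAt (fun l : ℝ => l ^ (n + 1) * h (l • t)) (l ^ n * G (l • t)) l := by
    intro t ht l hl
    have h1 := hd (l • t) (smul_ne_zero hl.ne' ht)
    have h2 : HasDerivAt (fun x : ℝ => x / l) (1 / l) l := (hasDerivAt_id l).div_const l
    have h1' : HasDerivAt (fun x : ℝ => h (x • l • t)) (G (l • t) - (n + 1) * h (l • t)) (l / l) := by
      rw [div_self hl.ne']; exact h1
    have h3 := HasDerivAt.comp (h := fun x : ℝ => x / l) l h1' h2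
    have h4 : HasDerivAt (fun x : ℝ => h (x • t)) ((G (l • t) - (n + 1) * h (l • t)) * (1 / l)) l := by
      refine h3.congr_of_eventuallyEq (Eventually.of_forall fun x => ?_)
      simp only [Function.comp, smul_smul]
      rw [div_mul_cancel₀ _ hl.ne']
    have h5 := (hasDerivAt_pow (n + 1) l).mul h4
    refine h5.congr_deriv ?_
    simp only [Nat.add_sub_cancel]
    push_cast
    field_simp
    ring
  have hsc : ∀ l : ℝ, 0 < l → ∀ f : E → ℝ, ∫ t, f (l • t) ∂μ = (l ^ (n + 1))⁻¹ * ∫ t, f t ∂μ := by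
    intro l hl f
    rw [Measure.integral_comp_smul, hn, abs_of_pos (by positivity)]
    rfl
  set ν : Measure ℝ := volume.restrict (Set.Ioc 1 2) with hν
  have hprod : Integrable (fun z : ℝ × E => z.1 ^ n * G (z.1 • z.2)) (ν.prod μ) := by
    have hm : Measurable (fun z : ℝ × E => z.1 ^ n * G (z.1 • z.2)) :=
      (measurable_fst.pow_const n).mul (hGm.comp (measurable_fst.smul measurable_snd))
    rw [integrable_prod_iff hm.aestronglyMeasurable]
    constructor
    · rw [hν]
      filter_upwards [ae_restrict_mem measurableSet_Ioc] with l hl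
      have : Integrable (fun t => G (l • t)) μ :=
        (integrable_comp_smul_iff μ G (by have := hl.1; positivity)).2 hG
      exact this.const_mul _
    · have : IntegrableOn (fun l : ℝ => l⁻¹ * ∫ t, |G t| ∂μ) (Set.Ioc 1 2) := by
        rw [← intervalIntegrable_iff_integrableOn_Ioc_of_le (by norm_num)]
        refine (ContinuousOn.intervalIntegrable ?_)
        refine ContinuousOn.mul (continuousOn_inv₀.mono ?_) continuousOn_const
        intro x hx
        rw [Set.uIcc_of_le (by norm_num)] at hx
        have := hx.1
        simp; linarith
      refine this.congr ?_
      filter_upwards [ae_restrict_mem measurableSet_Ioc] with l hl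
      have hl0 : 0 < l := by have := hl.1; linarith
      have e : ∀ t, ‖l ^ n * G (l • t)‖ = l ^ n * |G (l • t)| := by
        intro t
        rw [Real.norm_eq_abs, abs_mul, abs_of_pos (by positivity)]
      simp_rw [e]
      rw [integral_const_mul, hsc l hl0 (fun t => |G t|)]
      field_simp
      ring
  have hswap := integral_integral_swap (f := fun (l : ℝ) (t : E) => l ^ n * G (l • t)) hprod
  have hL : ∫ l, ∫ t, l ^ n * G (l • t) ∂μ ∂ν = Real.log 2 * ∫ t, G t ∂μ := by
    have : ∀ᵐ l ∂ν, ∫ t, l ^ n * G (l • t) ∂μ = l⁻¹ * ∫ t, G t ∂μ := by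
      filter_upwards [ae_restrict_mem measurableSet_Ioc] with l hl
      have hl0 : 0 < l := by have := hl.1; linarith
      rw [integral_const_mul, hsc l hl0 G]
      field_simp
      ring
    rw [integral_congr_ae this, integral_mul_const, hν,
      ← intervalIntegral.integral_of_le (by norm_num), integral_inv_of_pos (by norm_num) (by norm_num)]
    norm_num
  have hR : ∫ t, ∫ l, l ^ n * G (l • t) ∂ν ∂μ = 0 := by
    have h0 : ∀ᵐ t ∂μ, t ≠ (0 : E) := by
      simp [ae_iff]
    have : ∀ᵐ t ∂μ, ∫ l, l ^ n * G (l • t) ∂ν = 2 ^ (n + 1) * h ((2 : ℝ) • t) - h t := by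
      filter_upwards [h0, hprod.prod_left_ae] with t ht hi
      have := intervalIntegral.integral_eq_sub_of_hasDerivAt (a := 1) (b := 2)
        (f := fun l : ℝ => l ^ (n + 1) * h (l • t)) (f' := fun l : ℝ => l ^ n * G (l • t))
        (fun x hx => hd2 t ht x (by
          rw [Set.uIcc_of_le (by norm_num)] at hx
          have := hx.1; linarith))
        ((intervalIntegrable_iff_integrableOn_Ioc_of_le (by norm_num)).2 hi)
      rw [hν, ← intervalIntegral.integral_of_le (by norm_num), this]
      simp
    rw [integral_congr_ae this, integral_sub, integral_const_mul, hsc 2 (by norm_num) h]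
    · field_simp
      ring
    · exact ((integrable_comp_smul_iff μ h (by norm_num)).2 hh).const_mul _
    · exact hh
  rw [hL, hR] at hswap
  rcases mul_eq_zero.1 hswap with h | h
  · exact absurd h (Real.log_pos (by norm_num)).ne'
  · exact h

theorem weight1_int (m : ℕ) (α β p : ℝ) (hα : 0 < α) (hβ : α < β) (hp : p = ((m : ℝ) + 2 + α) / 2) :
    Integrable (fun t : ES m => min ‖t‖ (‖t‖ ^ (1 + β)) / (‖t‖ ^ 2) ^ p) := by
  rw [integrable_fun_norm_addHaar (volume : Measure (ES m))
    (f := fun r : ℝ => min r (r ^ (1 + β)) / (r ^ 2) ^ p)]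
  have hfr : Module.finrank ℝ (ES m) - 1 = m := by simp
  rw [hfr]
  have hmeas : Measurable (fun y : ℝ => y ^ m • (min y (y ^ (1 + β)) / (y ^ 2) ^ p)) := by
    simp only [smul_eq_mul]; fun_prop
  have e2p : ∀ y : ℝ, 0 < y → (y ^ 2) ^ p = y ^ ((m : ℝ) + 2 + α) := by
    intro y hy
    rw [← Real.rpow_natCast, ← Real.rpow_mul hy.le, hp]
    congr 1; push_cast; ring
  rw [← Set.Ioc_union_Ioi_eq_Ioi (zero_le_one' ℝ)]
  refine IntegrableOn.union ?_ ?_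
  · have h1 : IntegrableOn (fun y : ℝ => y ^ (β - α - 1)) (Set.Ioc 0 1) := by
      rw [← intervalIntegrable_iff_integrableOn_Ioc_of_le zero_le_one]
      exact intervalIntegral.intervalIntegrable_rpow' (by linarith)
    refine Integrable.mono' h1 hmeas.aestronglyMeasurable ?_
    filter_upwards [ae_restrict_mem measurableSet_Ioc] with y hy
    have hy0 : 0 < y := hy.1
    rw [e2p y hy0, Real.norm_of_nonneg (by positivity), smul_eq_mul]
    calc y ^ m * (min y (y ^ (1 + β)) / y ^ ((m : ℝ) + 2 + α))
        ≤ y ^ m * (y ^ (1 + β) / y ^ ((m : ℝ) + 2 + α)) := by gcongr; exact min_le_right _ _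
      _ = y ^ (β - α - 1) := by
        rw [← Real.rpow_sub hy0, ← Real.rpow_natCast, ← Real.rpow_add hy0]
        congr 1; ring
  · have h1 : IntegrableOn (fun y : ℝ => y ^ (-1 - α)) (Set.Ioi 1) :=
      integrableOn_Ioi_rpow_of_lt (by linarith) zero_lt_one
    refine Integrable.mono' h1 hmeas.aestronglyMeasurable ?_
    filter_upwards [ae_restrict_mem measurableSet_Ioi] with y hy
    have hy0 : 0 < y := zero_lt_one.trans hy
    rw [e2p y hy0, Real.norm_of_nonneg (by positivity), smul_eq_mul]
    calc y ^ m * (min y (y ^ (1 + β)) / y ^ ((m : ℝ) + 2 + α))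
        ≤ y ^ m * (y ^ (1 : ℝ) / y ^ ((m : ℝ) + 2 + α)) := by
          gcongr; rw [Real.rpow_one]; exact min_le_left _ _
      _ = y ^ (-1 - α) := by
        rw [← Real.rpow_sub hy0, ← Real.rpow_natCast, ← Real.rpow_add hy0]
        congr 1; ring

theorem weight2_int (m : ℕ) (α p κ : ℝ) (hα : 0 < α) (hκ : 0 < κ) (hp : p = ((m : ℝ) + 2 + α) / 2) :
    Integrable (fun t : ES m => (1 + ‖t‖ ^ 2) ^ (1 / 2 : ℝ) / (κ * (1 + ‖t‖ ^ 2)) ^ p) := by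
  have h := (integrable_rpow_neg_one_add_norm_sq (E := ES m) (μ := volume) (r := (m : ℝ) + 1 + α)
    (by simp; linarith)).const_mul ((κ ^ p)⁻¹)
  refine h.congr (Eventually.of_forall fun t => ?_)
  have h1 : 0 < 1 + ‖t‖ ^ 2 := by positivity
  simp only
  rw [Real.mul_rpow hκ.le h1.le, mul_comm (κ ^ p), ← div_div, ← Real.rpow_sub h1, hp,
    div_eq_mul_inv, mul_comm]
  congr 2; ring

theorem case2 (m : ℕ) (α p : ℝ) (hα : 0 < α) (hp : p = ((m : ℝ) + 2 + α) / 2)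
    (a : ES m → ℝ) (a' : ES m → ES m →L[ℝ] ℝ) (b : ES m → ℝ)
    (b' : ES m → ES m →L[ℝ] ℝ) (ha : ∀ t, HasFDerivAt a (a' t) t)
    (hb : ∀ t, HasFDerivAt b (b' t) t) (ha' : Continuous a') (hb' : Continuous b')
    (A d : ℝ) (hA : 0 ≤ A) (hd : 0 < d) (h1 : ∀ t, |a t| ≤ A) (h2 : ∀ t, |b t| ≤ A)
    (h3 : ∀ t, ‖a' t‖ ≤ A) (h4 : ∀ t, ‖b' t‖ ≤ A) (h5 : ∀ t, d ≤ a t) :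
    Integrable (fun t => b t / (‖t‖ ^ 2 + a t ^ 2) ^ p) ∧
    HasDerivAt (fun c : ℝ => ∫ t, ((a t + c * b t) - (a' t t + c * b' t t)) /
      (‖t‖ ^ 2 + (a t + c * b t) ^ 2) ^ p) (-α * ∫ t, b t / (‖t‖ ^ 2 + a t ^ 2) ^ p) 0 := by
  have hac : Continuous a := continuous_iff_continuousAt.2 fun t => (ha t).continuousAt
  have hbc : Continuous b := continuous_iff_continuousAt.2 fun t => (hb t).continuousAt
  have hp0 : 0 < p := by rw [hp]; positivity
  set κ : ℝ := min 1 (d ^ 2 / 4) with hκ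
  have hκ0 : 0 < κ := lt_min one_pos (by positivity)
  set r : ℝ := min 1 (d / (2 * (A + 1))) with hr
  have hr0 : 0 < r := lt_min one_pos (by positivity)
  set C : ℝ := 2 * A + 2 * A ^ 2 / κ with hC
  have hC0 : 0 ≤ C := by positivity
  have hC1 : 2 * A ≤ C := by rw [hC]; have : 0 ≤ 2 * A ^ 2 / κ := by positivity
                             linarith
  have hC2 : 2 * A ^ 2 ≤ C * κ := by
    rw [hC, add_mul, div_mul_cancel₀ _ hκ0.ne']
    have : 0 ≤ 2 * A * κ := by positivity
    linarith
  have hw := weight2_int m α p κ hα hκ0 hp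
  have hw1 : ∀ t : ES m, 1 ≤ (1 + ‖t‖ ^ 2) ^ (1 / 2 : ℝ) := by
    intro t
    exact Real.one_le_rpow (by nlinarith [sq_nonneg ‖t‖]) (by norm_num)
  have hwt : ∀ t : ES m, ‖t‖ ≤ (1 + ‖t‖ ^ 2) ^ (1 / 2 : ℝ) := by
    intro t
    rw [← Real.sqrt_eq_rpow]
    exact Real.le_sqrt_of_sq_le (by linarith)
  have hlow : ∀ c : ℝ, |c| < r → ∀ t, κ * (1 + ‖t‖ ^ 2) ≤ ‖t‖ ^ 2 + (a t + c * b t) ^ 2 := by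
    intro c hc t
    have e1 : |c * b t| ≤ d / 2 := by
      rw [abs_mul]
      have e : |c| ≤ d / (2 * (A + 1)) := hc.le.trans (min_le_right _ _)
      calc |c| * |b t| ≤ d / (2 * (A + 1)) * (A + 1) :=
            mul_le_mul e ((h2 t).trans (by linarith)) (abs_nonneg _) (by positivity)
        _ = d / 2 := by field_simp
    have e2 : d / 2 ≤ a t + c * b t := by
      have := h5 t; have := (abs_le.1 e1).1; linarith
    have e3 : d ^ 2 / 4 ≤ (a t + c * b t) ^ 2 := by nlinarith
    have e4 : κ ≤ 1 := min_le_left _ _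
    have e5 : κ ≤ d ^ 2 / 4 := min_le_right _ _
    nlinarith [sq_nonneg ‖t‖]
  have hgen : ∀ (f : ES m → ℝ) (f' : ES m → ES m →L[ℝ] ℝ), (∀ t, |f t| ≤ A) → (∀ t, ‖f' t‖ ≤ A) →
      ∀ t, |f t - f' t t| ≤ C * (1 + ‖t‖ ^ 2) ^ (1 / 2 : ℝ) := by
    intro f f' hf hf' t
    have e1 : |f' t t| ≤ A * ‖t‖ := by
      have := (f' t).le_of_opNorm_le (hf' t) t
      simpa using this
    have e2 := abs_sub (f t) (f' t t)
    have e3 := mul_le_mul_of_nonneg_left (hwt t) hA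
    have e4 := mul_le_mul_of_nonneg_left (hw1 t) hA
    have e5 := mul_le_mul_of_nonneg_right hC1 (zero_le_one.trans (hw1 t))
    have := hf t
    linarith
  have key := deriv_int p hp0 a a' b b' hac ha' hbc hb' C r hC0 hr0 (min_le_left _ _)
    (fun t => (1 + ‖t‖ ^ 2) ^ (1 / 2 : ℝ)) (fun t => κ * (1 + ‖t‖ ^ 2))
    (hgen a a' h1 h3) (hgen b b' h2 h4) (fun t _ => by positivity) hlow ?_ hw
  · have hint : Integrable (fun t => b t / (‖t‖ ^ 2 + a t ^ 2) ^ p) := by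
      refine (hw.const_mul A).mono' (kernel_meas p hbc hac).aestronglyMeasurable
        (Eventually.of_forall fun t => ?_)
      have hK := hlow 0 (by simpa using hr0) t
      simp only [zero_mul, add_zero] at hK
      have hk : 0 < κ * (1 + ‖t‖ ^ 2) := by positivity
      rw [Real.norm_eq_abs, abs_div, abs_of_pos (Real.rpow_pos_of_pos (hk.trans_le hK) p),
        ← mul_div_assoc]
      refine div_le_div₀ (by positivity) ?_ (Real.rpow_pos_of_pos hk p)
        (Real.rpow_le_rpow hk.le hK hp0.le)
      have := mul_le_mul_of_nonneg_left (hw1 t) hA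
      have := h2 t
      linarith
    refine ⟨hint, ?_⟩
    have hG : Integrable (fun t => -α * (b t / (‖t‖ ^ 2 + a t ^ 2) ^ p) - Dk p a a' b b' t) :=
      (hint.const_mul _).sub key.1
    have := scaling_aux (volume : Measure (ES m)) m (by simp) _ _ hint hG
      (((kernel_meas p hbc hac).const_mul _).sub (Dk_meas p a a' b b' hac ha' hbc hb')) ?_
    · rw [integral_sub (hint.const_mul _) key.1, integral_const_mul] at this
      rw [show -α * ∫ t, b t / (‖t‖ ^ 2 + a t ^ 2) ^ p = ∫ t, Dk p a a' b b' t by linarith]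
      exact key.2
    · intro t ht
      refine (radial_deriv p a a' b b' ha hb t ht).congr_deriv ?_
      rw [hp]; ring
  · intro c hc t
    have e0 := hlow c hc t
    have e1 : |a t + c * b t| ≤ 2 * A := by
      have := abs_add_le (a t) (c * b t)
      rw [abs_mul] at this
      have := mul_le_mul (hc.le.trans (min_le_left _ _)) (h2 t) (abs_nonneg _) zero_le_one
      have := h1 t
      linarith
    rw [abs_mul]
    have e2 := mul_le_mul e1 (h2 t) (abs_nonneg _) (by positivity)
    have e3 := mul_le_mul_of_nonneg_left e0 hC0
    have e4 : 0 ≤ C * κ * ‖t‖ ^ 2 := by positivity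
    nlinarith

theorem inv_diff (p z x y : ℝ) (hp : 0 < p) (hz : 0 < z) (hx : z ≤ x) (hy : z ≤ y) :
    |(y ^ p)⁻¹ - (x ^ p)⁻¹| ≤ p * (z ^ (p + 1))⁻¹ * |y - x| := by
  have hd : ∀ w ∈ Set.Ici z, HasDerivWithinAt (fun w : ℝ => w ^ (-p)) (-p * w ^ (-p - 1)) (Set.Ici z) w := by
    intro w hw
    exact (Real.hasDerivAt_rpow_const (Or.inl (hz.trans_le hw).ne')).hasDerivWithinAt
  have := (convex_Ici z).norm_image_sub_le_of_norm_hasDerivWithin_le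
    (C := p * (z ^ (p + 1))⁻¹) hd (fun w hw => ?_) hx hy
  · simp only [Real.norm_eq_abs] at this
    rwa [Real.rpow_neg (hz.trans_le hx).le, Real.rpow_neg (hz.trans_le hy).le] at this
  · have hw0 := hz.trans_le hw
    rw [Real.norm_eq_abs, abs_mul, abs_neg, abs_of_pos hp, abs_of_pos (Real.rpow_pos_of_pos hw0 _),
      show -p - 1 = -(p + 1) by ring, Real.rpow_neg hw0.le]
    gcongr
    exact hw

theorem case1 (m : ℕ) (α β p : ℝ) (hα : 0 < α) (hβ : α < β) (hp : p = ((m : ℝ) + 2 + α) / 2)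
    (a : ES m → ℝ) (a' : ES m → ES m →L[ℝ] ℝ) (b : ES m → ℝ)
    (b' : ES m → ES m →L[ℝ] ℝ) (ha : ∀ t, HasFDerivAt a (a' t) t)
    (hb : ∀ t, HasFDerivAt b (b' t) t) (ha' : Continuous a') (hb' : Continuous b')
    (A : ℝ) (hA : 0 ≤ A) (h1 : ∀ t, |a t| ≤ A * ‖t‖) (h2 : ∀ t, |b t| ≤ A * ‖t‖)
    (h3 : ∀ t, |a t - a' t t| ≤ A * min ‖t‖ (‖t‖ ^ (1 + β)))
    (h4 : ∀ t, |b t - b' t t| ≤ A * min ‖t‖ (‖t‖ ^ (1 + β)))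
    (h5 : ∀ t, |a t + a (-t)| ≤ A * min ‖t‖ (‖t‖ ^ (1 + β)))
    (h6 : ∀ t, |b t + b (-t)| ≤ A * min ‖t‖ (‖t‖ ^ (1 + β))) :
    ∃ L : ℝ, Tendsto (fun ε : ℝ => ∫ t in {t : ES m | ε ≤ ‖t‖}, b t / (‖t‖ ^ 2 + a t ^ 2) ^ p)
        (𝓝[>] (0 : ℝ)) (𝓝 L) ∧
    HasDerivAt (fun c : ℝ => ∫ t, ((a t + c * b t) - (a' t t + c * b' t t)) /
      (‖t‖ ^ 2 + (a t + c * b t) ^ 2) ^ p) (-α * L) 0 := by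
  have hac : Continuous a := continuous_iff_continuousAt.2 fun t => (ha t).continuousAt
  have hbc : Continuous b := continuous_iff_continuousAt.2 fun t => (hb t).continuousAt
  have hp0 : 0 < p := by rw [hp]; positivity
  have hw := weight1_int m α β p hα hβ hp
  have h0 : ∀ᵐ t : ES m, t ≠ 0 := by simp [ae_iff]
  set w : ES m → ℝ := fun t => min ‖t‖ (‖t‖ ^ (1 + β)) with hwdef
  have hw0 : ∀ t, 0 ≤ w t := fun t => le_min (norm_nonneg _) (Real.rpow_nonneg (norm_nonneg _) _)
  have hC : ∀ t, A * w t ≤ (2 * A ^ 2 + A) * w t := fun t => by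
    have := mul_nonneg (by positivity : 0 ≤ 2 * A ^ 2) (hw0 t)
    nlinarith
  have key := deriv_int p hp0 a a' b b' hac ha' hbc hb' (2 * A ^ 2 + A) 1 (by positivity) one_pos le_rfl
    w (fun t => ‖t‖ ^ 2) (fun t => (h3 t).trans (hC t)) (fun t => (h4 t).trans (hC t))
    (fun t ht => by have := norm_pos_iff.2 ht; positivity)
    (fun c _ t => by nlinarith [sq_nonneg (a t + c * b t)]) ?_ hw
  swap
  · intro c hc t
    have e1 : |a t + c * b t| ≤ 2 * A * ‖t‖ := by
      have := abs_add_le (a t) (c * b t)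
      rw [abs_mul] at this
      have := mul_le_mul hc.le (h2 t) (abs_nonneg _) zero_le_one
      have := h1 t
      linarith
    rw [abs_mul]
    have e2 := mul_le_mul e1 (h2 t) (abs_nonneg _) (by positivity)
    have e3 := mul_nonneg (by positivity : 0 ≤ 2 * A ^ 2 + A) (sq_nonneg (a t + c * b t))
    have e4 := mul_nonneg hA (sq_nonneg ‖t‖)
    nlinarith
  set h : ES m → ℝ := fun t => b t / (‖t‖ ^ 2 + a t ^ 2) ^ p with hh
  have hm : Measurable h := kernel_meas p hbc hac
  set hs : ES m → ℝ := fun t => h t + h (-t) with hhs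
  have hsm : Measurable hs := hm.add (hm.comp measurable_neg)
  have hsint : Integrable hs := by
    refine (hw.const_mul (A + 2 * p * A ^ 3)).mono' hsm.aestronglyMeasurable ?_
    filter_upwards [h0] with t ht
    have hT : 0 < ‖t‖ := norm_pos_iff.2 ht
    have hT2 : 0 < ‖t‖ ^ 2 := by positivity
    have hk1 : ‖t‖ ^ 2 ≤ ‖t‖ ^ 2 + a t ^ 2 := by nlinarith [sq_nonneg (a t)]
    have hk2 : ‖t‖ ^ 2 ≤ ‖t‖ ^ 2 + a (-t) ^ 2 := by nlinarith [sq_nonneg (a (-t))]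
    have hZ : 0 < (‖t‖ ^ 2) ^ p := Real.rpow_pos_of_pos hT2 p
    have hi := inv_diff p _ _ _ hp0 hT2 hk1 hk2
    have hZ1 : ((‖t‖ ^ 2 + a t ^ 2) ^ p)⁻¹ ≤ ((‖t‖ ^ 2) ^ p)⁻¹ :=
      inv_anti₀ hZ (Real.rpow_le_rpow hT2.le hk1 hp0.le)
    have hZ10 : 0 ≤ ((‖t‖ ^ 2 + a t ^ 2) ^ p)⁻¹ := by positivity
    have hb1 : |b (-t)| ≤ A * ‖t‖ := by simpa using h2 (-t)
    have ha1 : |a (-t)| ≤ A * ‖t‖ := by simpa using h1 (-t)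
    have hdiff : |‖t‖ ^ 2 + a (-t) ^ 2 - (‖t‖ ^ 2 + a t ^ 2)| ≤ (A * w t) * (2 * A * ‖t‖) := by
      rw [show ‖t‖ ^ 2 + a (-t) ^ 2 - (‖t‖ ^ 2 + a t ^ 2) = (a t + a (-t)) * (a (-t) - a t) by ring,
        abs_mul]
      refine mul_le_mul (h5 t) ?_ (abs_nonneg _) (by have := hw0 t; positivity)
      have := abs_sub (a (-t)) (a t)
      have := h1 t
      linarith
    have e : hs t = (b t + b (-t)) * ((‖t‖ ^ 2 + a t ^ 2) ^ p)⁻¹ +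
        b (-t) * (((‖t‖ ^ 2 + a (-t) ^ 2) ^ p)⁻¹ - ((‖t‖ ^ 2 + a t ^ 2) ^ p)⁻¹) := by
      simp only [hhs, hh, norm_neg]; ring
    have t1 : |(b t + b (-t)) * ((‖t‖ ^ 2 + a t ^ 2) ^ p)⁻¹| ≤ A * w t * ((‖t‖ ^ 2) ^ p)⁻¹ := by
      rw [abs_mul, abs_of_nonneg hZ10]
      exact mul_le_mul (h6 t) hZ1 hZ10 (by have := hw0 t; positivity)
    have t2 : |b (-t) * (((‖t‖ ^ 2 + a (-t) ^ 2) ^ p)⁻¹ - ((‖t‖ ^ 2 + a t ^ 2) ^ p)⁻¹)| ≤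
        (A * ‖t‖) * (p * ((‖t‖ ^ 2) ^ (p + 1))⁻¹ * ((A * w t) * (2 * A * ‖t‖))) := by
      rw [abs_mul]
      refine mul_le_mul hb1 (hi.trans ?_) (abs_nonneg _) (by positivity)
      gcongr
    have t3 : (A * ‖t‖) * (p * ((‖t‖ ^ 2) ^ (p + 1))⁻¹ * ((A * w t) * (2 * A * ‖t‖))) =
        2 * p * A ^ 3 * (w t / (‖t‖ ^ 2) ^ p) := by
      rw [Real.rpow_add_one hT2.ne']
      generalize (‖t‖ ^ 2) ^ p = Z at *
      field_simp
    rw [Real.norm_eq_abs, e]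
    refine (abs_add_le _ _).trans ?_
    rw [t3] at t2
    have t4 : A * w t * ((‖t‖ ^ 2) ^ p)⁻¹ = A * (w t / (‖t‖ ^ 2) ^ p) := by
      rw [div_eq_mul_inv]; ring
    have t5 := add_le_add (t1.trans (le_of_eq t4)) t2
    rw [← add_mul] at t5
    exact t5
  have hDneg : Integrable (fun t => Dk p a a' b b' (-t)) := key.1.comp_neg
  have hadd : Integrable (fun t => Dk p a a' b b' t + Dk p a a' b b' (-t)) := key.1.add hDneg
  have hG : Integrable (fun t => -α * hs t - (Dk p a a' b b' t + Dk p a a' b b' (-t))) :=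
    (hsint.const_mul _).sub hadd
  have hDm := Dk_meas p a a' b b' hac ha' hbc hb'
  have hzero := scaling_aux (volume : Measure (ES m)) m (by simp) _ _ hsint hG
      ((hsm.const_mul _).sub (hDm.add (hDm.comp measurable_neg))) (by
    intro t ht
    have r1 := radial_deriv p a a' b b' ha hb t ht
    have r2 := radial_deriv p a a' b b' ha hb (-t) (neg_ne_zero.2 ht)
    simp only [smul_neg] at r2
    refine (r1.add r2).congr_deriv ?_
    simp only [hhs, hh]
    rw [hp]; ring)
  rw [integral_sub (hsint.const_mul _) hadd, integral_const_mul,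
    integral_add key.1 hDneg, integral_neg_eq_self] at hzero
  refine ⟨1 / 2 * ∫ t, hs t, ?_, ?_⟩
  swap
  · rw [show -α * (1 / 2 * ∫ t, hs t) = ∫ t, Dk p a a' b b' t by linarith]
    exact key.2
  have hset : ∀ ε : ℝ, MeasurableSet {t : ES m | ε ≤ ‖t‖} := fun ε =>
    measurableSet_le measurable_const measurable_norm
  have hion : ∀ ε : ℝ, 0 < ε → IntegrableOn h {t : ES m | ε ≤ ‖t‖} := by
    intro ε hε
    refine Integrable.mono' ((hw.const_mul (A * (1 + (ε ^ β)⁻¹))).integrableOn) hm.aestronglyMeasurable ?_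
    filter_upwards [ae_restrict_mem (hset ε)] with t ht
    have ht : ε ≤ ‖t‖ := ht
    have hT : 0 < ‖t‖ := hε.trans_le ht
    have hT2 : 0 < ‖t‖ ^ 2 := by positivity
    have hk1 : ‖t‖ ^ 2 ≤ ‖t‖ ^ 2 + a t ^ 2 := by nlinarith [sq_nonneg (a t)]
    have hεβ : 0 < ε ^ β := Real.rpow_pos_of_pos hε β
    have hle : ‖t‖ ≤ (1 + (ε ^ β)⁻¹) * w t := by
      simp only [hwdef]
      rcases min_cases ‖t‖ (‖t‖ ^ (1 + β)) with ⟨e, _⟩ | ⟨e, _⟩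
      · rw [e]
        have : 0 < (ε ^ β)⁻¹ * ‖t‖ := by positivity
        linarith
      · rw [e, Real.rpow_add hT, Real.rpow_one]
        have e1 : ε ^ β ≤ ‖t‖ ^ β := Real.rpow_le_rpow hε.le ht (hα.trans hβ).le
        have e2 : 1 ≤ (ε ^ β)⁻¹ * ‖t‖ ^ β := by
          rw [inv_mul_eq_div, le_div_iff₀ hεβ]; linarith
        have e3 : 0 < ‖t‖ * ‖t‖ ^ β := by positivity
        nlinarith
    rw [Real.norm_eq_abs, hh, abs_div, abs_of_pos (Real.rpow_pos_of_pos (hT2.trans_le hk1) p),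
      ← mul_div_assoc]
    refine div_le_div₀ (by have := hw0 t; positivity) ?_ (Real.rpow_pos_of_pos hT2 p)
      (Real.rpow_le_rpow hT2.le hk1 hp0.le)
    have := mul_le_mul_of_nonneg_left hle hA
    have := h2 t
    linarith
  have hhalf : ∀ ε : ℝ, 0 < ε → ∫ t in {t : ES m | ε ≤ ‖t‖}, h t =
      1 / 2 * ∫ t in {t : ES m | ε ≤ ‖t‖}, hs t := by
    intro ε hε
    have i1 := hion ε hε
    have eneg : ∀ t, Set.indicator {t : ES m | ε ≤ ‖t‖} h (-t) =
        Set.indicator {t : ES m | ε ≤ ‖t‖} (fun t => h (-t)) t := by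
      intro t
      by_cases ht : ε ≤ ‖t‖
      · rw [Set.indicator_of_mem, Set.indicator_of_mem] <;> simpa using ht
      · rw [Set.indicator_of_notMem, Set.indicator_of_notMem] <;> simpa using ht
    have i2 : IntegrableOn (fun t => h (-t)) {t : ES m | ε ≤ ‖t‖} := by
      rw [← integrable_indicator_iff (hset ε)] at i1 ⊢
      exact i1.comp_neg.congr (Eventually.of_forall eneg)
    have i3 : ∫ t in {t : ES m | ε ≤ ‖t‖}, h (-t) = ∫ t in {t : ES m | ε ≤ ‖t‖}, h t := by
      rw [← integral_indicator (hset ε), ← integral_indicator (hset ε),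
        ← integral_neg_eq_self (Set.indicator _ h)]
      exact integral_congr_ae (Eventually.of_forall fun t => (eneg t).symm)
    simp only [hhs]
    rw [integral_add i1 i2, i3]; ring
  have hlim : Tendsto (fun ε : ℝ => ∫ t in {t : ES m | ε ≤ ‖t‖}, hs t) (𝓝[>] 0) (𝓝 (∫ t, hs t)) := by
    have : ∀ ε : ℝ, ∫ t in {t : ES m | ε ≤ ‖t‖}, hs t =
      ∫ t, Set.indicator {t : ES m | ε ≤ ‖t‖} hs t := fun ε => (integral_indicator (hset ε)).symm
    simp_rw [this]
    refine tendsto_integral_filter_of_dominated_convergence (fun t => ‖hs t‖) ?_ ?_ hsint.norm ?_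
    · exact Eventually.of_forall fun ε => (hsm.indicator (hset ε)).aestronglyMeasurable
    · exact Eventually.of_forall fun ε => Eventually.of_forall fun t => norm_indicator_le_norm_self _ _
    · filter_upwards [h0] with t ht
      have hT : 0 < ‖t‖ := norm_pos_iff.2 ht
      refine tendsto_const_nhds.congr' ?_
      filter_upwards [mem_nhdsWithin_of_mem_nhds (Iio_mem_nhds hT)] with ε hε
      rw [Set.indicator_of_mem]
      exact le_of_lt (Set.mem_Iio.1 hε)
  refine (hlim.const_mul (1 / 2)).congr' ?_
  filter_upwards [self_mem_nhdsWithin] with ε hε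
  exact (hhalf ε hε).symm

theorem est {m : ℕ} (β : ℝ) (hβ : 0 < β) (u : ES m → ℝ) (hu : IsC1Beta β u) :
    ∃ A : ℝ, 0 ≤ A ∧ (∀ x, |u x| ≤ A) ∧ (∀ x, ‖fderiv ℝ u x‖ ≤ A) ∧
      (∀ x y, |u y - u x| ≤ A * ‖y - x‖) ∧
      ∀ x y, |u y - u x - fderiv ℝ u x (y - x)| ≤ A * min ‖y - x‖ (‖y - x‖ ^ (1 + β)) := by
  obtain ⟨hc, ⟨C1, h1⟩, ⟨C2, h2⟩, ⟨C3, h3⟩⟩ := hu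
  have hdiff : Differentiable ℝ u := hc.differentiable one_ne_zero
  have hC1 : 0 ≤ C1 := (abs_nonneg _).trans (h1 0)
  have hC2 : 0 ≤ C2 := (norm_nonneg _).trans (h2 0)
  have hlip : ∀ x y, |u y - u x| ≤ C2 * ‖y - x‖ := by
    intro x y
    exact convex_univ.norm_image_sub_le_of_norm_fderiv_le (𝕜 := ℝ) (fun z _ => hdiff z)
      (fun z _ => h2 z) (Set.mem_univ x) (Set.mem_univ y)
  refine ⟨C1 + 2 * C2 + |C3|, by positivity, fun x => ?_, fun x => ?_, fun x y => ?_, fun x y => ?_⟩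
  · have := h1 x; have := abs_nonneg C3; linarith
  · have := h2 x; have := abs_nonneg C3; linarith
  · refine (hlip x y).trans ?_
    gcongr
    have := abs_nonneg C3; linarith
  · rw [mul_min_of_nonneg _ _ (by positivity)]
    refine le_min ?_ ?_
    · have e1 := hlip x y
      have e2 : |fderiv ℝ u x (y - x)| ≤ C2 * ‖y - x‖ := (fderiv ℝ u x).le_of_opNorm_le (h2 x) _
      have e3 := abs_sub (u y - u x) (fderiv ℝ u x (y - x))
      have e4 : 0 ≤ (C1 + |C3|) * ‖y - x‖ := by positivity
      linarith
    · have hb : ∀ z ∈ Metric.closedBall x ‖y - x‖,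
          ‖fderiv ℝ u z - fderiv ℝ u x‖ ≤ |C3| * ‖y - x‖ ^ β := by
        intro z hz
        have hz : ‖z - x‖ ≤ ‖y - x‖ := by simpa [dist_eq_norm] using hz
        refine (h3 z x).trans ?_
        calc C3 * ‖z - x‖ ^ β ≤ |C3| * ‖z - x‖ ^ β := by gcongr; exact le_abs_self _
          _ ≤ |C3| * ‖y - x‖ ^ β := by gcongr
      have := (convex_closedBall x ‖y - x‖).norm_image_sub_le_of_norm_hasFDerivWithin_le'
        (f := u) (f' := fderiv ℝ u) (φ := fderiv ℝ u x)
        (fun z _ => (hdiff z).hasFDerivAt.hasFDerivWithinAt) hb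
        (Metric.mem_closedBall_self (norm_nonneg _)) (y := y) (by simp [dist_eq_norm])
      rw [Real.norm_eq_abs] at this
      refine this.trans ?_
      have e : ‖y - x‖ ^ (1 + β) = ‖y - x‖ ^ β * ‖y - x‖ := by
        rw [Real.rpow_add' (norm_nonneg _) (by linarith), Real.rpow_one, mul_comm]
      rw [e, mul_assoc]
      gcongr
      linarith

theorem est_diff {m : ℕ} (β A B : ℝ) (u : ES m → ℝ) (s : ES m) (hAB : 2 * A ≤ B) (hA : 0 ≤ A)
    (h4 : ∀ x y, |u y - u x| ≤ A * ‖y - x‖)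
    (h5 : ∀ x y, |u y - u x - fderiv ℝ u x (y - x)| ≤ A * min ‖y - x‖ (‖y - x‖ ^ (1 + β))) :
    (∀ t, |u s - u (s - t)| ≤ B * ‖t‖) ∧
    (∀ t, |u s - u (s - t) - fderiv ℝ u (s - t) t| ≤ B * min ‖t‖ (‖t‖ ^ (1 + β))) ∧
    (∀ t, |u s - u (s - t) + (u s - u (s - -t))| ≤ B * min ‖t‖ (‖t‖ ^ (1 + β))) := by
  have hw0 : ∀ t : ES m, 0 ≤ min ‖t‖ (‖t‖ ^ (1 + β)) :=
    fun t => le_min (norm_nonneg _) (Real.rpow_nonneg (norm_nonneg _) _)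
  refine ⟨fun t => ?_, fun t => ?_, fun t => ?_⟩
  · have := h4 (s - t) s
    rw [sub_sub_cancel] at this
    refine this.trans ?_
    gcongr
    linarith
  · have := h5 (s - t) s
    rw [sub_sub_cancel] at this
    refine this.trans ?_
    have := hw0 t
    gcongr
    linarith
  · have e1 := h5 s (s - t)
    have e2 := h5 s (s - -t)
    rw [show s - t - s = -t by abel, norm_neg, map_neg] at e1
    rw [show s - -t - s = t by abel] at e2
    have e3 := mul_le_mul_of_nonneg_right hAB (hw0 t)
    rw [abs_le] at *
    constructor <;> linarith [e1.1, e1.2, e2.1, e2.2]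

/-- the directional derivative of the nonlocal mean curvature operator `H` at
`u` in the direction `v` exists and equals
`2 PV ∫ (v(s)-v(s-t))/(|t|²+(u(s)-u(s-t))²)^{(N+α)/2} dt
 - 2 ∫ (v(s)+v(s-t))/(|t|²+(u(s)+u(s-t))²)^{(N+α)/2} dt`,
where the principal value exists and the second integral converges absolutely.
Here `N = m + 2 ≥ 2`. -/
theorem statement_17 (m : ℕ) (α β : ℝ) (hα : α ∈ Set.Ioo (0 : ℝ) 1)
    (hβ : β ∈ Set.Ioo α 1) (u v : ES m → ℝ) (hu : IsC1Beta β u) (hv : IsC1Beta β v)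
    (hpos : ∃ δ > 0, ∀ x, δ ≤ u x) (s : ES m) :
    ∃ L : ℝ,
      Tendsto
        (fun ε : ℝ => ∫ t in {t : ES m | ε ≤ ‖t‖},
          (v s - v (s - t)) / (‖t‖ ^ 2 + (u s - u (s - t)) ^ 2) ^ (((m : ℝ) + 2 + α) / 2))
        (𝓝[>] (0 : ℝ)) (𝓝 L) ∧
      Integrable (fun t : ES m =>
        (v s + v (s - t)) / (‖t‖ ^ 2 + (u s + u (s - t)) ^ 2) ^ (((m : ℝ) + 2 + α) / 2)) ∧
      Tendsto
        (fun ς : ℝ => (Hop m α (fun x => u x + ς * v x) s - Hop m α u s) / ς)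
        (𝓝[≠] (0 : ℝ))
        (𝓝 (2 * L -
          2 * ∫ t : ES m,
            (v s + v (s - t)) / (‖t‖ ^ 2 + (u s + u (s - t)) ^ 2) ^ (((m : ℝ) + 2 + α) / 2))) := by
  obtain ⟨hα0, hα1⟩ := hα
  obtain ⟨hβα, hβ1⟩ := hβ
  obtain ⟨d, hd, hdu⟩ := hpos
  have hβ0 : 0 < β := hα0.trans hβα
  obtain ⟨A, hA, hA1, hA2, hA3, hA4⟩ := est β hβ0 u hu
  obtain ⟨B, hB, hB1, hB2, hB3, hB4⟩ := est β hβ0 v hv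
  have hdu' : Differentiable ℝ u := hu.1.differentiable one_ne_zero
  have hdv' : Differentiable ℝ v := hv.1.differentiable one_ne_zero
  have hcu : Continuous (fderiv ℝ u) := hu.1.continuous_fderiv one_ne_zero
  have hcv : Continuous (fderiv ℝ v) := hv.1.continuous_fderiv one_ne_zero
  have hsub : ∀ f : ES m → ℝ, Differentiable ℝ f → ∀ t,
      HasFDerivAt (fun t => f (s - t)) (-fderiv ℝ f (s - t)) t := by
    intro f hf t
    have h1 : HasFDerivAt (fun t : ES m => s - t) (-ContinuousLinearMap.id ℝ (ES m)) t :=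
      (hasFDerivAt_id t).const_sub s
    have h2 := HasFDerivAt.comp t (hf (s - t)).hasFDerivAt h1
    refine h2.congr_fderiv ?_
    ext z; simp
  obtain ⟨a1, a2, a3⟩ := est_diff β A (2 * A + 2 * B) u s (by linarith) hA hA3 hA4
  obtain ⟨b1, b2, b3⟩ := est_diff β B (2 * A + 2 * B) v s (by linarith) hB hB3 hB4
  obtain ⟨L, hL1, hL2⟩ := case1 m α β (((m : ℝ) + 2 + α) / 2) hα0 hβα rfl
    (fun t => u s - u (s - t)) (fun t => fderiv ℝ u (s - t))
    (fun t => v s - v (s - t)) (fun t => fderiv ℝ v (s - t))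
    (fun t => by simpa using (hsub u hdu' t).const_sub (u s))
    (fun t => by simpa using (hsub v hdv' t).const_sub (v s))
    (by fun_prop) (by fun_prop) (2 * A + 2 * B) (by positivity) a1 b1 a2 b2 a3 b3
  have hbd : ∀ (f : ES m → ℝ) (M : ℝ), (∀ x, |f x| ≤ M) → 2 * M ≤ 2 * A + 2 * B →
      ∀ t, |f s + f (s - t)| ≤ 2 * A + 2 * B := by
    intro f M hM hle t
    have := abs_add_le (f s) (f (s - t))
    have := hM s
    have := hM (s - t)
    linarith
  obtain ⟨hQ1, hQ2⟩ := case2 m α (((m : ℝ) + 2 + α) / 2) hα0 rfl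
    (fun t => u s + u (s - t)) (fun t => -fderiv ℝ u (s - t))
    (fun t => v s + v (s - t)) (fun t => -fderiv ℝ v (s - t))
    (fun t => (hsub u hdu' t).const_add (u s))
    (fun t => (hsub v hdv' t).const_add (v s))
    (by fun_prop) (by fun_prop) (2 * A + 2 * B) d (by positivity) hd
    (hbd u A hA1 (by linarith)) (hbd v B hB1 (by linarith))
    (fun t => by rw [norm_neg]; have := hA2 (s - t); linarith)
    (fun t => by rw [norm_neg]; have := hB2 (s - t); linarith)
    (fun t => by have := hdu s; have := hdu (s - t); linarith)
  refine ⟨L, hL1, hQ1, ?_⟩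
  have hfd : ∀ (c : ℝ) (x t : ES m), fderiv ℝ (fun x => u x + c * v x) x t =
      fderiv ℝ u x t + c * fderiv ℝ v x t := by
    intro c x t
    have := ((hdu' x).hasFDerivAt.add ((hdv' x).hasFDerivAt.const_mul c)).fderiv
    have e : (fun x => u x + c * v x) = u + fun x => c * v x := rfl
    rw [e, this]; simp
  have hHop : ∀ c : ℝ, Hop m α (fun x => u x + c * v x) s = -(2 / α) *
      ((∫ t : ES m, ((u s - u (s - t) + c * (v s - v (s - t))) -
          (fderiv ℝ u (s - t) t + c * fderiv ℝ v (s - t) t)) /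
          (‖t‖ ^ 2 + (u s - u (s - t) + c * (v s - v (s - t))) ^ 2) ^ (((m : ℝ) + 2 + α) / 2)) -
        ∫ t : ES m, ((u s + u (s - t) + c * (v s + v (s - t))) -
          ((-fderiv ℝ u (s - t)) t + c * (-fderiv ℝ v (s - t)) t)) /
          (‖t‖ ^ 2 + (u s + u (s - t) + c * (v s + v (s - t))) ^ 2) ^ (((m : ℝ) + 2 + α) / 2)) := by
    intro c
    unfold Hop
    congr 2
    · refine integral_congr_ae (Eventually.of_forall fun t => ?_)
      simp only [hfd]
      congr 1
      · ring
      · congr 1; ring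
    · refine integral_congr_ae (Eventually.of_forall fun t => ?_)
      simp only [hfd, neg_apply]
      congr 1
      · ring
      · congr 1; ring
  have hder := (hL2.sub hQ2).const_mul (-(2 / α))
  have hder2 : HasDerivAt (fun c : ℝ => Hop m α (fun x => u x + c * v x) s) (2 * L -
          2 * ∫ t : ES m,
            (v s + v (s - t)) / (‖t‖ ^ 2 + (u s + u (s - t)) ^ 2) ^ (((m : ℝ) + 2 + α) / 2)) 0 := by
    refine (hder.congr_of_eventuallyEq (Eventually.of_forall fun c => hHop c)).congr_deriv ?_
    field_simp
    ring
  refine (hasDerivAt_iff_tendsto_slope_zero.1 hder2).congr fun c => ?_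
  simp [div_eq_inv_mul]
end
end
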